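/- Let a, b, c > 0 with c ≥ 2.639·max(a,b). Then there is an absolute constant K > 0, independent of n, a, b, c, such that π(C_FL ∪ C_AFL) ≤ K·n³·(c/min(a,b))·(2.639·max(a,b)/c)^{n−1}; in particular π(C_FL ∪ C_AFL) ≤ O(n)·(2.639·max(a,b)/c)^n, which is exponentially small in n. -/

import Mathlib

open Finset

/-! Six-vertex model on the `n × n` square lattice region `Λ_n` with free
boundary conditions.

`Edge.horiz k j` is the horizontal edge between `x = k-1` and `x = k` at
height `j`; `Edge.vert i k` is the vertical edge between `y = k-1` and
`y = k` on column `i`.  The vertices of `Λ_n` are the pairs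
`(i, j) : Fin n × Fin n`.  An edge configuration assigns `true`
(rightwards / upwards) or `false` (leftwards / downwards) to every edge. -/
inductive Edge (n : ℕ) : Type
  | horiz (k : Fin (n + 1)) (j : Fin n) : Edge n
  | vert (i : Fin n) (k : Fin (n + 1)) : Edge n
  deriving DecidableEq, Fintype

abbrev EdgeConfig (n : ℕ) := Edge n → Bool

/-- The four edges incident to the vertex `(i, j)` of `Λ_n`. -/
def leftE {n : ℕ} (i j : Fin n) : Edge n := Edge.horiz i.castSucc j
def rightE {n : ℕ} (i j : Fin n) : Edge n := Edge.horiz i.succ j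
def botE {n : ℕ} (i j : Fin n) : Edge n := Edge.vert i j.castSucc
def topE {n : ℕ} (i j : Fin n) : Edge n := Edge.vert i j.succ

/-- The in-degree of the vertex `(i, j)` in the configuration `τ`. -/
def inDegree {n : ℕ} (τ : EdgeConfig n) (i j : Fin n) : ℕ :=
  (cond (τ (leftE i j)) 1 0) + (cond (τ (rightE i j)) 0 1) +
    (cond (τ (botE i j)) 1 0) + (cond (τ (topE i j)) 0 1)

/-- The ice rule: every vertex has exactly two incoming (and hence two
outgoing) incident edges; such a configuration is an Eulerian orientation. -/
def IceRule {n : ℕ} (τ : EdgeConfig n) : Prop :=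
  ∀ i j : Fin n, inDegree τ i j = 2

instance {n : ℕ} (τ : EdgeConfig n) : Decidable (IceRule τ) :=
  inferInstanceAs (Decidable (∀ i j : Fin n, inDegree τ i j = 2))

/-- `Ω`, the state space: all Eulerian orientations of `Λ_n`. -/
def OmegaSet (n : ℕ) : Set (EdgeConfig n) := {τ | IceRule τ}

/-- The state `τ_G`, in which every vertex has six-vertex type `c`. -/
def greenOrient {n : ℕ} : Edge n → Bool
  | Edge.horiz k j => (k.val + j.val) % 2 == 0
  | Edge.vert i k => (i.val + k.val) % 2 == 1

def tauG (n : ℕ) : EdgeConfig n := greenOrient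

/-- The state `τ_R`, the total edge reversal of `τ_G`. -/
def tauR (n : ℕ) : EdgeConfig n := fun e => !(greenOrient e)

/-- An edge is green in `τ` if it is oriented as in `τ_G`, red otherwise. -/
def greenB {n : ℕ} (τ : EdgeConfig n) (e : Edge n) : Bool := τ e == greenOrient e

def IsGreen {n : ℕ} (τ : EdgeConfig n) (e : Edge n) : Prop := τ e = greenOrient e
def IsRed {n : ℕ} (τ : EdgeConfig n) (e : Edge n) : Prop := τ e = !(greenOrient e)

/-- Incidence between edges and vertices of `Λ_n`. -/
def EdgeIncident {n : ℕ} : Edge n → Fin n × Fin n → Prop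
  | Edge.horiz k j', (i, j) => j' = j ∧ (k = i.castSucc ∨ k = i.succ)
  | Edge.vert i' k, (i, j) => i' = i ∧ (k = j.castSucc ∨ k = j.succ)

/-- Two (distinct) edges are adjacent if they share an incident `Λ_n`-vertex. -/
def EdgeAdj {n : ℕ} (e f : Edge n) : Prop :=
  e ≠ f ∧ ∃ v : Fin n × Fin n, EdgeIncident e v ∧ EdgeIncident f v

/-- A simple (self-avoiding) monochromatic path of edges of colour `g`
(`true` = green, `false` = red). -/
def MonoPath {n : ℕ} (τ : EdgeConfig n) (g : Bool) (p : List (Edge n)) : Prop :=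
  p ≠ [] ∧ p.Nodup ∧ List.Chain' EdgeAdj p ∧ ∀ e ∈ p, greenB τ e = g

/-- A horizontal monochromatic bridge: a simple monochromatic path from a
horizontal edge on the left boundary to a horizontal edge on the right
boundary of `Λ_n`. -/
def IsHorizBridge {n : ℕ} (τ : EdgeConfig n) (g : Bool) (p : List (Edge n)) : Prop :=
  MonoPath τ g p ∧ (∃ j, p.head? = some (Edge.horiz 0 j)) ∧
    (∃ j, p.getLast? = some (Edge.horiz (Fin.last n) j))

/-- A vertical monochromatic bridge, from the top boundary to the bottom. -/
def IsVertBridge {n : ℕ} (τ : EdgeConfig n) (g : Bool) (p : List (Edge n)) : Prop :=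
  MonoPath τ g p ∧ (∃ i, p.head? = some (Edge.vert i (Fin.last n))) ∧
    (∃ i, p.getLast? = some (Edge.vert i 0))

def HorizGreenBridge {n : ℕ} (τ : EdgeConfig n) : Prop := ∃ p, IsHorizBridge τ true p
def HorizRedBridge {n : ℕ} (τ : EdgeConfig n) : Prop := ∃ p, IsHorizBridge τ false p
def VertGreenBridge {n : ℕ} (τ : EdgeConfig n) : Prop := ∃ p, IsVertBridge τ true p
def VertRedBridge {n : ℕ} (τ : EdgeConfig n) : Prop := ∃ p, IsVertBridge τ false p

def HasGreenCross {n : ℕ} (τ : EdgeConfig n) : Prop :=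
  HorizGreenBridge τ ∧ VertGreenBridge τ

def HasRedCross {n : ℕ} (τ : EdgeConfig n) : Prop :=
  HorizRedBridge τ ∧ VertRedBridge τ

/-- `C_G`: the states with a green cross. -/
def CG (n : ℕ) : Set (EdgeConfig n) := {τ | IceRule τ ∧ HasGreenCross τ}

/-- `C_R`: the states with a red cross. -/
def CR (n : ℕ) : Set (EdgeConfig n) := {τ | IceRule τ ∧ HasRedCross τ}

/-! The shifted lattice `L = ℤ² + (1/2, 1/2)`, restricted to the region inside
`Λ_n`.  The `L_n`-vertex `(i, j) : Fin (n+1) × Fin (n+1)` represents the point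
`(i - 1/2, j - 1/2)`; its boundary vertices are those with a coordinate equal
to `0` or `n`.  An `L_n`-edge is a diagonal passing through exactly one
`Λ_n`-vertex; it is recorded as that `Λ_n`-vertex together with a Boolean
(`true` for the NE–SW diagonal, `false` for the NW–SE diagonal). -/
abbrev LVertex (n : ℕ) := Fin (n + 1) × Fin (n + 1)

abbrev LEdge (n : ℕ) := (Fin n × Fin n) × Bool

/-- The two `L_n`-endpoints of an `L_n`-edge. -/
def lEdgeEnds {n : ℕ} : LEdge n → LVertex n × LVertex n
  | ((i, j), true) => ((i.castSucc, j.castSucc), (i.succ, j.succ))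
  | ((i, j), false) => ((i.succ, j.castSucc), (i.castSucc, j.succ))

/-- The `L_n`-edge `e` joins the `L_n`-vertices `u` and `v`. -/
def StepOnEdge {n : ℕ} (e : LEdge n) (u v : LVertex n) : Prop :=
  lEdgeEnds e = (u, v) ∨ lEdgeEnds e = (v, u)

/-- Adjacency in the lattice `L_n`. -/
def LAdjacent {n : ℕ} (u v : LVertex n) : Prop :=
  ∃ e : LEdge n, StepOnEdge e u v

/-- Membership of an `L_n`-edge in `L_τ`: the four `Λ_n`-edges incident to the
`Λ_n`-vertex it passes through are two green and two red, and the edge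
separates the two green edges from the two red ones. -/
def lTau {n : ℕ} (τ : EdgeConfig n) : LEdge n → Bool
  | ((i, j), true) =>
      (greenB τ (leftE i j) == greenB τ (topE i j)) &&
        (greenB τ (rightE i j) == greenB τ (botE i j)) &&
        !(greenB τ (leftE i j) == greenB τ (rightE i j))
  | ((i, j), false) =>
      (greenB τ (leftE i j) == greenB τ (botE i j)) &&
        (greenB τ (rightE i j) == greenB τ (topE i j)) &&
        !(greenB τ (leftE i j) == greenB τ (rightE i j))

/-- A step between two `L_n`-vertices along an edge of `L_τ`. -/
def LStep {n : ℕ} (τ : EdgeConfig n) (u v : LVertex n) : Prop :=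
  ∃ e : LEdge n, StepOnEdge e u v ∧ lTau τ e = true

/-- The consecutive steps of a path given as a list of vertices. -/
def pathSteps {α : Type*} (p : List α) : List (α × α) := p.zip p.tail

/-- A vertical fault line: a self-avoiding path of `L_τ`-edges from an
`L_n`-vertex on the top boundary to an `L_n`-vertex on the bottom boundary. -/
def IsVertFaultLine {n : ℕ} (τ : EdgeConfig n) (p : List (LVertex n)) : Prop :=
  p ≠ [] ∧ p.Nodup ∧ List.Chain' (LStep τ) p ∧
    (∃ u, p.head? = some u ∧ u.2 = Fin.last n) ∧
    (∃ u, p.getLast? = some u ∧ u.2 = 0)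

/-- A horizontal fault line: from the left boundary to the right boundary. -/
def IsHorizFaultLine {n : ℕ} (τ : EdgeConfig n) (p : List (LVertex n)) : Prop :=
  p ≠ [] ∧ p.Nodup ∧ List.Chain' (LStep τ) p ∧
    (∃ u, p.head? = some u ∧ u.1 = 0) ∧
    (∃ u, p.getLast? = some u ∧ u.1 = Fin.last n)

def HasVertFaultLine {n : ℕ} (τ : EdgeConfig n) : Prop := ∃ p, IsVertFaultLine τ p
def HasHorizFaultLine {n : ℕ} (τ : EdgeConfig n) : Prop := ∃ p, IsHorizFaultLine τ p

/-- `C_FL`: the states with a (horizontal or vertical) fault line. -/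
def CFL (n : ℕ) : Set (EdgeConfig n) :=
  {τ | IceRule τ ∧ (HasHorizFaultLine τ ∨ HasVertFaultLine τ)}

/-- A vertical almost fault line: a self-avoiding `L_n`-path from the top
boundary to the bottom boundary all of whose edges except exactly one
belong to `L_τ`. -/
def IsVertAlmostFaultLine {n : ℕ} (τ : EdgeConfig n) (p : List (LVertex n)) : Prop :=
  p ≠ [] ∧ p.Nodup ∧ List.Chain' LAdjacent p ∧
    (∃ u, p.head? = some u ∧ u.2 = Fin.last n) ∧
    (∃ u, p.getLast? = some u ∧ u.2 = 0) ∧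
    ∃ s ∈ pathSteps p, ¬ LStep τ s.1 s.2 ∧
      ∀ t ∈ pathSteps p, t ≠ s → LStep τ t.1 t.2

/-- A horizontal almost fault line. -/
def IsHorizAlmostFaultLine {n : ℕ} (τ : EdgeConfig n) (p : List (LVertex n)) : Prop :=
  p ≠ [] ∧ p.Nodup ∧ List.Chain' LAdjacent p ∧
    (∃ u, p.head? = some u ∧ u.1 = 0) ∧
    (∃ u, p.getLast? = some u ∧ u.1 = Fin.last n) ∧
    ∃ s ∈ pathSteps p, ¬ LStep τ s.1 s.2 ∧
      ∀ t ∈ pathSteps p, t ≠ s → LStep τ t.1 t.2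

/-- `C_AFL`: the states with an almost fault line. -/
def CAFL (n : ℕ) : Set (EdgeConfig n) :=
  {τ | IceRule τ ∧
    ((∃ p, IsHorizAlmostFaultLine τ p) ∨ (∃ p, IsVertAlmostFaultLine τ p))}

/-- The weight of the vertex `(i, j)`: `c` for the two `c`-type configurations
(both horizontal edges in, or both out), and `a` or `b` for the others. -/
noncomputable def vertexWeight {n : ℕ} (a b c : ℝ) (τ : EdgeConfig n)
    (i j : Fin n) : ℝ :=
  if τ (leftE i j) ≠ τ (rightE i j) then c
  else if τ (leftE i j) = τ (botE i j) then a else b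

/-- The weight `w(τ)` of a state: the product of the vertex weights. -/
noncomputable def weight {n : ℕ} (a b c : ℝ) (τ : EdgeConfig n) : ℝ :=
  ∏ v : Fin n × Fin n, vertexWeight a b c τ v.1 v.2

/-- The partition function `Z`. -/
noncomputable def Zsum (n : ℕ) (a b c : ℝ) : ℝ :=
  ∑ τ ∈ Finset.univ.filter (fun τ : EdgeConfig n => IceRule τ), weight a b c τ

open Classical in
/-- The Gibbs measure of a set of states, `π(S) = (Σ_{τ∈S} w(τ))/Z`. -/
noncomputable def piSet (n : ℕ) (a b c : ℝ) (S : Set (EdgeConfig n)) : ℝ :=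
  (∑ τ ∈ Finset.univ.filter (fun τ : EdgeConfig n => τ ∈ S), weight a b c τ) /
    Zsum n a b c

/-- The four edges (bottom, right, top, left) of the unit square of `ℤ²`
whose lower-left corner is the `Λ_n`-vertex `(i, j)`. -/
def squareEdges (n : ℕ) (i j : ℕ) (hi : i + 1 < n) (hj : j + 1 < n) :
    Edge n × Edge n × Edge n × Edge n :=
  (Edge.horiz ⟨i + 1, by omega⟩ ⟨j, by omega⟩,
    Edge.vert ⟨i + 1, by omega⟩ ⟨j + 1, by omega⟩,
    Edge.horiz ⟨i + 1, by omega⟩ ⟨j + 1, by omega⟩,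
    Edge.vert ⟨i, by omega⟩ ⟨j + 1, by omega⟩)

/-- The four edges (bottom, right, top, left) around a unit square form a
directed cycle, i.e. are consistently oriented. -/
def DirectedSquare {n : ℕ} (τ : EdgeConfig n)
    (e : Edge n × Edge n × Edge n × Edge n) : Prop :=
  (τ e.1 = true ∧ τ e.2.1 = true ∧ τ e.2.2.1 = false ∧ τ e.2.2.2 = false) ∨
    (τ e.1 = false ∧ τ e.2.1 = false ∧ τ e.2.2.1 = true ∧ τ e.2.2.2 = true)

/-- Reversing the orientations of the four edges around a unit square. -/
def flipSquare {n : ℕ} (τ : EdgeConfig n)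
    (e : Edge n × Edge n × Edge n × Edge n) : EdgeConfig n :=
  fun f => if f = e.1 ∨ f = e.2.1 ∨ f = e.2.2.1 ∨ f = e.2.2.2 then !(τ f) else τ f

/-- A move of the Glauber dynamics `M_G` at the unit square with lower-left
corner `(i, j)`: the four edges around the square are consistently oriented
in `τ`, and `τ'` is obtained from `τ` by reversing them. -/
def GlauberMoveAt {n : ℕ} (τ τ' : EdgeConfig n) (i j : ℕ)
    (hi : i + 1 < n) (hj : j + 1 < n) : Prop :=
  DirectedSquare τ (squareEdges n i j hi hj) ∧
    τ' = flipSquare τ (squareEdges n i j hi hj)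

/-- A move of the Glauber dynamics `M_G`. -/
def GlauberMove {n : ℕ} (τ τ' : EdgeConfig n) : Prop :=
  ∃ (i j : ℕ) (hi : i + 1 < n) (hj : j + 1 < n), GlauberMoveAt τ τ' i j hi hj

/-- `∂C_G`: the states outside `C_G` that are one move of `M_G` away from
`C_G`. -/
def boundaryCG (n : ℕ) : Set (EdgeConfig n) :=
  {τ | IceRule τ ∧ τ ∉ CG n ∧ ∃ σ ∈ CG n, GlauberMove σ τ}

/-- The state space `Ω` as a type. -/
abbrev OmegaT (n : ℕ) := {τ : EdgeConfig n // IceRule τ}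

open Classical in
/-- Metropolis transition rate of `M_G` between two distinct states: propose
one of the `(n-1)²` unit squares uniformly at random and accept the flip with
probability `min 1 (w(τ')/w(τ))`. -/
noncomputable def metro {n : ℕ} (a b c : ℝ) (τ τ' : OmegaT n) : ℝ :=
  if GlauberMove τ.1 τ'.1 then
    (1 / (((n : ℝ) - 1) * ((n : ℝ) - 1))) *
      min 1 (weight a b c τ'.1 / weight a b c τ.1)
  else 0

/-- The transition matrix of the Glauber dynamics `M_G`. -/
noncomputable def transP {n : ℕ} (a b c : ℝ) (τ τ' : OmegaT n) : ℝ :=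
  if τ' = τ then 1 - ∑ σ ∈ Finset.univ.erase τ, metro a b c τ σ
  else metro a b c τ τ'

/-- The `t`-step transition probabilities of `M_G`. -/
noncomputable def transPow {n : ℕ} (a b c : ℝ) : ℕ → OmegaT n → OmegaT n → ℝ
  | 0, τ, τ' => if τ = τ' then 1 else 0
  | t + 1, τ, τ' => ∑ σ : OmegaT n, transPow a b c t τ σ * transP a b c σ τ'

/-- The stationary Gibbs distribution `π` on `Ω`. -/
noncomputable def piDist {n : ℕ} (a b c : ℝ) (τ : OmegaT n) : ℝ :=
  weight a b c τ.1 / Zsum n a b c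

/-- Total variation distance between two distributions on `Ω`. -/
noncomputable def tvDist {n : ℕ} (μ ν : OmegaT n → ℝ) : ℝ :=
  (∑ τ : OmegaT n, |μ τ - ν τ|) / 2

/-- The mixing time of `M_G`: the smallest `t` after which the total variation
distance to `π` is at most `1/4` from any starting state. -/
noncomputable def mixingTime (n : ℕ) (a b c : ℝ) : ℕ :=
  sInf {t : ℕ | ∀ τ₀ : OmegaT n,
    tvDist (transPow a b c t τ₀) (piDist a b c) ≤ 1 / 4}

/-- The number of green edges incident to the vertex `(i, j)` in `τ`. -/
def greenCountAt {n : ℕ} (τ : EdgeConfig n) (i j : Fin n) : ℕ :=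
  (cond (greenB τ (leftE i j)) 1 0) + (cond (greenB τ (rightE i j)) 1 0) +
    (cond (greenB τ (botE i j)) 1 0) + (cond (greenB τ (topE i j)) 1 0)

/-- The number of `L_τ`-edges incident to the `L_n`-vertex `u`. -/
def lTauDegree {n : ℕ} (τ : EdgeConfig n) (u : LVertex n) : ℕ :=
  (Finset.univ.filter (fun e : LEdge n =>
    lTau τ e = true ∧ ((lEdgeEnds e).1 = u ∨ (lEdgeEnds e).2 = u))).card

/-- The number of colour changes encountered when going rotationally
(bottom, right, top, left) around the four `Λ_n`-edges surrounding the
internal `L_n`-vertex `(i, j)` (representing the point `(i - 1/2, j - 1/2)`). -/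
def colorChangesAround (n : ℕ) (τ : EdgeConfig n) (i j : ℕ)
    (hi0 : 0 < i) (hin : i < n) (hj0 : 0 < j) (hjn : j < n) : ℕ :=
  let bo := greenB τ (Edge.horiz ⟨i, by omega⟩ ⟨j - 1, by omega⟩)
  let t := greenB τ (Edge.horiz ⟨i, by omega⟩ ⟨j, by omega⟩)
  let l := greenB τ (Edge.vert ⟨i - 1, by omega⟩ ⟨j, by omega⟩)
  let r := greenB τ (Edge.vert ⟨i, by omega⟩ ⟨j, by omega⟩)
  (cond (bo != r) 1 0) + (cond (r != t) 1 0) +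
    (cond (t != l) 1 0) + (cond (l != bo) 1 0)

section Switching

variable {ε V : Type*} [Fintype ε] [AddCommGroup V]

/-- The weight of an edge set, given by its indicator `F`. -/
noncomputable def chainWeight (y : ε → ℝ) (F : ε → ZMod 2) : ℝ :=
  ∏ e, if F e = 0 then 1 else y e

lemma chainWeight_nonneg {y : ε → ℝ} (hy : ∀ e, 0 ≤ y e) (F : ε → ZMod 2) :
    0 ≤ chainWeight y F :=
  prod_nonneg fun e _ => by split_ifs <;> simp [hy]

variable [DecidableEq ε]

open Classical in
/-- The total weight of the edge sets whose boundary agrees with `A` modulo `S`. -/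
noncomputable def cosetSum (bd : (ε → ZMod 2) →+ V) (S : AddSubgroup V) (y : ε → ℝ)
    (A : V) : ℝ :=
  ∑ F, if bd F - A ∈ S then chainWeight y F else 0

lemma cosetSum_nonneg (bd : (ε → ZMod 2) →+ V) (S : AddSubgroup V) {y : ε → ℝ}
    (hy : ∀ e, 0 ≤ y e) (A : V) : 0 ≤ cosetSum bd S y A :=
  sum_nonneg fun F _ => by split_ifs <;> simp [chainWeight_nonneg hy]

lemma cosetSum_zero_pos (bd : (ε → ZMod 2) →+ V) (S : AddSubgroup V) {y : ε → ℝ}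
    (hy : ∀ e, 0 ≤ y e) : 0 < cosetSum bd S y 0 := by
  classical
  refine lt_of_lt_of_le (b := chainWeight y (0 : ε → ZMod 2)) (by simp [chainWeight]) ?_
  unfold cosetSum
  refine le_trans (by simp) (single_le_sum (f := fun F => if bd F - 0 ∈ S then
    chainWeight y F else 0) (fun F _ => ?_) (mem_univ (0 : ε → ZMod 2)))
  split_ifs <;> simp [chainWeight_nonneg hy]

/-- The part of the weight of a pair of edge variables that is invariant under
toggling both of them. -/
noncomputable def openWeight (m y' : ℝ) (f g : ZMod 2) : ℝ := if f = g then m * y' else m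

/-- The complementary part of the weight of a pair of edge variables. -/
noncomputable def closedWeight (y m y' : ℝ) (f g : ZMod 2) : ℝ :=
  (if f = 0 then 1 else y) * (if g = 0 then 1 else y') - openWeight m y' f g

lemma ZMod.eq_one_of_ne_zero' {f : ZMod 2} (h : f ≠ 0) : f = 1 := by
  revert h; revert f; decide

lemma openWeight_nonneg {m y' : ℝ} (hm : 0 ≤ m) (hy' : 0 ≤ y') (f g : ZMod 2) :
    0 ≤ openWeight m y' f g := by
  unfold openWeight; split_ifs <;> positivity

lemma closedWeight_nonneg {y m y' : ℝ} (hm : 0 ≤ m) (hmy : m ≤ y) (hmy' : m ≤ y')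
    (hm1 : m * y' ≤ 1) (f g : ZMod 2) : 0 ≤ closedWeight y m y' f g := by
  unfold closedWeight openWeight
  rcases eq_or_ne f 0 with rfl | hf <;> rcases eq_or_ne g 0 with rfl | hg
  · simpa using hm1
  · simpa [hg, hg.symm] using hmy'
  · simpa [hf] using hmy
  · simp only [ZMod.eq_one_of_ne_zero' hf, ZMod.eq_one_of_ne_zero' hg]
    simp only [one_ne_zero, if_false, if_true]
    nlinarith

/-- The weight of a pair of edge sets when the edges in `ω` are open. -/
noncomputable def pairWeight (y m y' : ε → ℝ) (ω : Finset ε) (F G : ε → ZMod 2) : ℝ :=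
  (∏ e ∈ ω, openWeight (m e) (y' e) (F e) (G e)) *
    ∏ e ∈ univ \ ω, closedWeight (y e) (m e) (y' e) (F e) (G e)

lemma sum_pairWeight (y m y' : ε → ℝ) (F G : ε → ZMod 2) :
    ∑ ω, pairWeight y m y' ω F G = chainWeight y F * chainWeight y' G := by
  unfold pairWeight chainWeight
  rw [← prod_mul_distrib, ← powerset_univ, ← prod_add]
  refine prod_congr rfl fun e _ => ?_
  unfold closedWeight; ring

lemma pairWeight_add (y m y' : ε → ℝ) {ω : Finset ε} {K : ε → ZMod 2}
    (hK : ∀ e ∉ ω, K e = 0) (F G : ε → ZMod 2) :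
    pairWeight y m y' ω (F + K) (G + K) = pairWeight y m y' ω F G := by
  unfold pairWeight
  congr 1
  · exact prod_congr rfl fun e _ => by simp [openWeight]
  · refine prod_congr rfl fun e he => ?_
    simp [hK e (by simpa using he)]

/-- A switching principle: toggling both members of a pair of edge sets along a set
of open edges. -/
theorem switching_le {y m y' : ε → ℝ} (hm : ∀ e, 0 ≤ m e) (hmy : ∀ e, m e ≤ y e)
    (hmy' : ∀ e, m e ≤ y' e) (hm1 : ∀ e, m e * y' e ≤ 1)
    {φ φ' : (ε → ZMod 2) → (ε → ZMod 2) → ℝ} (hφ' : ∀ F G, 0 ≤ φ' F G)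
    (H : ∀ ω : Finset ε, (∃ F G, φ F G ≠ 0 ∧ ∀ e ∉ ω, F e ≠ 0 → m e ≠ y e) →
      ∃ K : ε → ZMod 2, (∀ e ∉ ω, K e = 0) ∧ ∀ F G, φ F G ≤ φ' (F + K) (G + K)) :
    ∑ F, ∑ G, chainWeight y F * chainWeight y' G * φ F G ≤
      ∑ F, ∑ G, chainWeight y F * chainWeight y' G * φ' F G := by
  have hnn : ∀ ω F G, 0 ≤ pairWeight y m y' ω F G := fun ω F G =>
    mul_nonneg (prod_nonneg fun e _ => openWeight_nonneg (hm e) ((hm e).trans (hmy' e)) _ _)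
      (prod_nonneg fun e _ => closedWeight_nonneg (hm e) (hmy e) (hmy' e) (hm1 e) _ _)
  have expand : ∀ ψ : (ε → ZMod 2) → (ε → ZMod 2) → ℝ,
      ∑ F, ∑ G, chainWeight y F * chainWeight y' G * ψ F G =
        ∑ ω, ∑ F, ∑ G, pairWeight y m y' ω F G * ψ F G := by
    intro ψ
    rw [sum_comm]
    conv_rhs => rw [sum_comm]
    rw [sum_comm]
    refine sum_congr rfl fun F _ => ?_
    rw [sum_comm]
    refine sum_congr rfl fun G _ => ?_
    rw [← sum_pairWeight y m y', sum_mul]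
  rw [expand, expand]
  refine sum_le_sum fun ω _ => ?_
  by_cases hω : ∃ F G, φ F G ≠ 0 ∧ ∀ e ∉ ω, F e ≠ 0 → m e ≠ y e
  · obtain ⟨K, hK, hφ⟩ := H ω hω
    calc ∑ F, ∑ G, pairWeight y m y' ω F G * φ F G
        ≤ ∑ F, ∑ G, pairWeight y m y' ω (F + K) (G + K) * φ' (F + K) (G + K) := by
          refine sum_le_sum fun F _ => sum_le_sum fun G _ => ?_
          rw [pairWeight_add y m y' hK]
          exact mul_le_mul_of_nonneg_left (hφ F G) (hnn _ _ _)
      _ = ∑ F, ∑ G, pairWeight y m y' ω F G * φ' F G := by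
          rw [← Equiv.sum_comp (Equiv.addRight K)
            (fun F => ∑ G, pairWeight y m y' ω F G * φ' F G)]
          refine sum_congr rfl fun F _ => ?_
          exact Equiv.sum_comp (Equiv.addRight K)
            (fun G => pairWeight y m y' ω (F + K) G * φ' (F + K) G)
  · push Not at hω
    refine sum_le_sum fun F _ => sum_le_sum fun G _ => ?_
    by_cases h0 : φ F G = 0
    · rw [h0, mul_zero]; exact mul_nonneg (hnn _ _ _) (hφ' _ _)
    · obtain ⟨e, heω, heF, hem⟩ := hω F G h0
      have hz : closedWeight (y e) (m e) (y' e) (F e) (G e) = 0 := by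
        unfold closedWeight openWeight
        rw [ZMod.eq_one_of_ne_zero' heF, hem]
        rcases eq_or_ne (G e) 0 with hg | hg
        · simp [hg]
        · simp [ZMod.eq_one_of_ne_zero' hg]
      have : pairWeight y m y' ω F G = 0 := by
        unfold pairWeight
        rw [prod_eq_zero (i := e) (s := univ \ ω) (by simpa using heω) hz, mul_zero]
      simp [this]

/-- The partition function with sources is at most the one without. -/
theorem cosetSum_le_zero (bd : (ε → ZMod 2) →+ V) (S : AddSubgroup V) {y : ε → ℝ}
    (hy : ∀ e, 0 ≤ y e) (hy1 : ∀ e, y e ≤ 1) (A : V) :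
    cosetSum bd S y A ≤ cosetSum bd S y 0 := by
  classical
  have sq : ∀ B, cosetSum bd S y B * cosetSum bd S y B = ∑ F, ∑ G,
      chainWeight y F * chainWeight y G *
        (if bd F - B ∈ S ∧ bd G - B ∈ S then 1 else 0) := by
    intro B
    unfold cosetSum
    rw [sum_mul_sum]
    refine sum_congr rfl fun F _ => sum_congr rfl fun G _ => ?_
    by_cases h1 : bd F - B ∈ S <;> by_cases h2 : bd G - B ∈ S <;> simp [h1, h2]
  refine (mul_self_le_mul_self_iff (cosetSum_nonneg bd S hy A) (cosetSum_nonneg bd S hy 0)).2 ?_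
  rw [sq, sq]
  refine switching_le (m := y) hy (fun _ => le_rfl) (fun _ => le_rfl)
    (fun e => mul_le_one₀ (hy1 e) (hy e) (hy1 e)) (fun F G => by split_ifs <;> simp) ?_
  rintro ω ⟨F₀, G₀, h0, hF₀⟩
  have hA : bd F₀ - A ∈ S := by
    by_contra h; simp [h] at h0
  refine ⟨-F₀, fun e he => ?_, fun F G => ?_⟩
  · by_contra h
    exact hF₀ e he (fun h' => h (by simp [h'])) rfl
  · have key : ∀ F, bd F - A ∈ S → bd (F + -F₀) - 0 ∈ S := by
      intro F hF
      have := S.sub_mem hF hA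
      simpa [← sub_eq_add_neg] using this
    by_cases h : bd F - A ∈ S ∧ bd G - A ∈ S
    · rw [if_pos h, if_pos ⟨key F h.1, key G h.2⟩]
    · rw [if_neg h]; split_ifs <;> simp

/-- `F` contains an edge set inside `D` with boundary `B`. -/
def ContainsChain (bd : (ε → ZMod 2) →+ V) (D : ε → Prop) (B : V) (F : ε → ZMod 2) : Prop :=
  ∃ K : ε → ZMod 2, (∀ e, K e ≠ 0 → F e ≠ 0 ∧ D e) ∧ bd K = B

open Classical in
/-- Edge sets containing a chain with boundary `B` inside `D` are controlled by the
source-free and the `B`-sourced partition functions on `D`. -/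
theorem switching_containsChain (bd : (ε → ZMod 2) →+ V) (S : AddSubgroup V)
    {y y' : ε → ℝ} {D : ε → Prop} (hy : ∀ e, 0 ≤ y e) (hy' : ∀ e, 0 ≤ y' e)
    (hyy' : ∀ e, D e → y e ≤ y' e) (hy1 : ∀ e, y e * y' e ≤ 1) (A B : V)
    {g : (ε → ZMod 2) → ℝ} (hg : ∀ F, 0 ≤ g F)
    (hgD : ∀ F K, (∀ e, K e ≠ 0 → D e) → g (F + K) = g F) :
    (∑ F, if bd F - A ∈ S ∧ ContainsChain bd D B F then chainWeight y F * g F else 0) *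
        cosetSum bd ⊥ y' 0 ≤
      (∑ F, if bd F - (A + B) ∈ S then chainWeight y F * g F else 0) *
        cosetSum bd ⊥ y' B := by
  have expand : ∀ (p : (ε → ZMod 2) → Prop) [DecidablePred p] (C : V),
      (∑ F, if p F then chainWeight y F * g F else 0) * cosetSum bd ⊥ y' C =
        ∑ F, ∑ G, chainWeight y F * chainWeight y' G *
          (if p F ∧ bd G = C then g F else 0) := by
    intro p _ C
    unfold cosetSum
    rw [sum_mul_sum]
    refine sum_congr rfl fun F _ => sum_congr rfl fun G _ => ?_
    by_cases h1 : p F <;> by_cases h2 : bd G = C <;>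
      simp [h1, h2, AddSubgroup.mem_bot, sub_eq_zero, mul_right_comm]
  rw [expand, expand]
  refine switching_le (m := fun e => if D e then y e else 0) (fun e => ?_) (fun e => ?_)
    (fun e => ?_) (fun e => ?_) (fun F G => ?_) ?_
  · split_ifs <;> simp [hy]
  · split_ifs <;> simp [hy]
  · split_ifs with h
    · exact hyy' e h
    · exact hy' e
  · split_ifs <;> simp [hy1]
  · split_ifs <;> simp [hg]
  rintro ω ⟨F₀, G₀, h0, hF₀⟩
  obtain ⟨K, hKF, hKB⟩ : ContainsChain bd D B F₀ := by
    by_contra h; simp [h] at h0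
  refine ⟨K, fun e he => ?_, fun F G => ?_⟩
  · by_contra h
    exact hF₀ e he (hKF e h).1 (by simp [(hKF e h).2])
  · by_cases h : (bd F - A ∈ S ∧ ContainsChain bd D B F) ∧ bd G = 0
    · have h1 : bd (F + K) - (A + B) ∈ S := by
        have : bd (F + K) - (A + B) = bd F - A := by rw [map_add, hKB]; abel
        rw [this]; exact h.1.1
      have h2 : bd (G + K) = B := by rw [map_add, hKB, h.2, zero_add]
      rw [if_pos h, if_pos ⟨h1, h2⟩, hgD F K fun e he => (hKF e he).2]
    · rw [if_neg h]; split_ifs <;> simp [hg]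

end Switching

section StripRecursion

/-- Summation along one strip of the right- and left-continued values at the sites
selected by the alternating indicator `b`. -/
lemma strip_sum_add {x : ℝ} {a l r b : ℕ → ℝ} {n : ℕ} (hb : ∀ i, b (i + 1) = 1 - b i)
    (hr : ∀ i < n, (1 + x ^ 2) * r i = (1 - x ^ 2) * a i - 2 * x * a (i + 1))
    (hl : ∀ i < n, (1 + x ^ 2) * l (i + 1) = 2 * x * a i + (1 - x ^ 2) * a (i + 1))
    (h0 : l 0 = a 0) (hn : r n = a n) :
    (1 + x ^ 2) * ∑ i ∈ range (n + 1), b i * (l i + r i) =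
      2 * (1 - x ^ 2) * ∑ i ∈ range (n + 1), b i * a i +
        2 * x ^ 2 * (b 0 * a 0 + b n * a n) +
        2 * x * ((1 - b 0) * a 0 - (1 - b n) * a n) := by
  have key : ∀ m ≤ n,
      (1 + x ^ 2) * (∑ i ∈ range m, b i * (l i + r i) + b m * (l m + a m)) =
        2 * (1 - x ^ 2) * ∑ i ∈ range (m + 1), b i * a i +
          2 * x ^ 2 * (b 0 * a 0 + b m * a m) +
          2 * x * ((1 - b 0) * a 0 - (1 - b m) * a m) := by
    intro m
    induction m with
    | zero => intro _; simp [h0]; ring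
    | succ m ih =>
      intro hm
      have := ih (by omega)
      rw [sum_range_succ _ (m + 1), sum_range_succ _ m]
      have h1 := hr m (by omega)
      have h2 := hl m (by omega)
      have h3 := hb m
      rw [h3]
      linear_combination this + b m * h1 + (1 - b m) * h2
  rw [sum_range_succ, hn]
  exact key n le_rfl

/-- The analogue of `strip_sum_add` on the other boundary of the strip. -/
lemma strip_sum_sub {x : ℝ} {a l r b : ℕ → ℝ} {n : ℕ} (hb : ∀ i, b (i + 1) = 1 - b i)
    (hr : ∀ i < n, (1 + x ^ 2) * r i = (1 - x ^ 2) * a i - 2 * x * a (i + 1))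
    (hl : ∀ i < n, (1 + x ^ 2) * l (i + 1) = 2 * x * a i + (1 - x ^ 2) * a (i + 1))
    (h0 : l 0 = a 0) (hn : r n = a n) :
    (1 + x ^ 2) * ∑ i ∈ range (n + 1), (1 - b i) * (l i - r i) =
      4 * x * ∑ i ∈ range (n + 1), b i * a i - 2 * x * (b 0 * a 0 + b n * a n) +
        2 * x ^ 2 * ((1 - b 0) * a 0 - (1 - b n) * a n) := by
  have key : ∀ m ≤ n,
      (1 + x ^ 2) * (∑ i ∈ range m, (1 - b i) * (l i - r i) + (1 - b m) * (l m - a m)) =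
        4 * x * ∑ i ∈ range (m + 1), b i * a i - 2 * x * (b 0 * a 0 + b m * a m) +
          2 * x ^ 2 * ((1 - b 0) * a 0 - (1 - b m) * a m) := by
    intro m
    induction m with
    | zero => intro _; simp [h0]; ring
    | succ m ih =>
      intro hm
      have := ih (by omega)
      rw [sum_range_succ _ (m + 1), sum_range_succ _ m]
      have h1 := hr m (by omega)
      have h2 := hl m (by omega)
      have h3 := hb m
      rw [h3]
      linear_combination this - (1 - b m) * h1 + b m * h2
  rw [sum_range_succ, hn]
  exact key n le_rfl

/-- The data of one strip: site values and their continuations to both sides. -/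
structure StripData (n : ℕ) (x : ℝ) (b a l r : ℕ → ℝ) : Prop where
  alt : ∀ i, b (i + 1) = 1 - b i
  right : ∀ i < n, (1 + x ^ 2) * r i = (1 - x ^ 2) * a i - 2 * x * a (i + 1)
  left : ∀ i < n, (1 + x ^ 2) * l (i + 1) = 2 * x * a i + (1 - x ^ 2) * a (i + 1)
  first : l 0 = a 0
  last : r n = a n
  first_bot : 0 ≤ b 0 * a 0
  first_top : 0 ≤ (1 - b 0) * a 0
  last_bot : 0 ≤ b n * a n
  last_top : (1 - b n) * a n ≤ 0

/-- Transfer from one strip to the next one. -/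
lemma StripData.transfer {n : ℕ} {x x' : ℝ} {b a l r a' l' r' : ℕ → ℝ} (hx : 0 ≤ x)
    (hx' : 0 ≤ x') (h : StripData n x b a l r)
    (h' : StripData n x' (fun i => 1 - b i) a' l' r')
    (hl : ∀ i ≤ n, (1 - b i) * l' i = (1 - b i) * l i)
    (hr : ∀ i ≤ n, (1 - b i) * r' i = -((1 - b i) * r i)) :
    (1 + x ^ 2) * ((1 - x' ^ 2) * ∑ i ∈ range (n + 1), (1 - b i) * a' i +
        x' ^ 2 * ((1 - b 0) * a' 0 + (1 - b n) * a' n)) ≤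
      (1 + x' ^ 2) * (2 * x * ∑ i ∈ range (n + 1), b i * a i +
        x ^ 2 * ((1 - b 0) * a' 0 + (1 - b n) * a' n)) := by
  have e1 := strip_sum_add (b := fun i => 1 - b i) h'.alt h'.right h'.left h'.first h'.last
  have e2 := strip_sum_sub h.alt h.right h.left h.first h.last
  have e3 : ∑ i ∈ range (n + 1), (1 - b i) * (l' i + r' i) =
      ∑ i ∈ range (n + 1), (1 - b i) * (l i - r i) := by
    refine sum_congr rfl fun i hi => ?_
    have hi : i ≤ n := by simpa [Nat.lt_succ_iff] using hi
    rw [mul_add, hl i hi, hr i hi]; ring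
  have e4 : (1 - b 0) * a' 0 = (1 - b 0) * a 0 := by
    rw [← h.first, ← h'.first]; exact hl 0 (Nat.zero_le _)
  have e5 : (1 - b n) * a' n = -((1 - b n) * a n) := by
    rw [← h.last, ← h'.last]; exact hr n le_rfl
  rw [e3] at e1
  set S := ∑ i ∈ range (n + 1), (1 - b i) * (l i - r i)
  have p1 : 0 ≤ x' * ((1 - (1 - b 0)) * a' 0 - (1 - (1 - b n)) * a' n) :=
    mul_nonneg hx' (sub_nonneg.2 (h'.last_top.trans h'.first_top))
  have p2 : 0 ≤ x * (b 0 * a 0 + b n * a n) :=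
    mul_nonneg hx (add_nonneg h.first_bot h.last_bot)
  have q1 := mul_nonneg (by positivity : (0 : ℝ) ≤ 1 + x ^ 2) p1
  have q2 := mul_nonneg (by positivity : (0 : ℝ) ≤ 1 + x' ^ 2) p2
  rw [← e4, show (1 - b n) * a n = -((1 - b n) * a' n) by linarith] at e2
  linear_combination ((1 + x' ^ 2) * e2 - (1 + x ^ 2) * e1) / 2 + q1 + q2

end StripRecursion

section Zigzag

/-- The `i`-th site of the zigzag path of parity `κ` in the `j`-th strip. -/
def zigzag (κ j i : ℕ) : ℕ × ℕ := (i, j + (i + j + κ) % 2)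

/-- The indicator of a site. -/
def site (w : ℕ × ℕ) : ℕ × ℕ → ZMod 2 := fun u => if u = w then 1 else 0

lemma site_add_self (w : ℕ × ℕ) : site w + site w = 0 := by
  funext u; simpa using CharTwo.add_self_eq_zero (site w u)

/-- The boundary of an edge set; the edge `(i, j)` joins consecutive sites of the
`j`-th zigzag path. -/
def boundary (κ n : ℕ) : (Fin n × Fin n → ZMod 2) →+ (ℕ × ℕ → ZMod 2) where
  toFun F := fun w => ∑ e, F e * (site (zigzag κ e.2 e.1) w + site (zigzag κ e.2 (e.1 + 1)) w)
  map_zero' := by funext w; simp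
  map_add' F G := by funext w; simp [add_mul, sum_add_distrib]

lemma boundary_apply (κ n : ℕ) (F : Fin n × Fin n → ZMod 2) (w : ℕ × ℕ) :
    boundary κ n F w =
      ∑ e, F e * (site (zigzag κ e.2 e.1) w + site (zigzag κ e.2 (e.1 + 1)) w) := rfl

lemma boundary_single (κ n : ℕ) (e : Fin n × Fin n) :
    boundary κ n (Pi.single e 1) = site (zigzag κ e.2 e.1) + site (zigzag κ e.2 (e.1 + 1)) := by
  funext w
  rw [boundary_apply, sum_eq_single e (fun f _ hf => by simp [Pi.single_eq_of_ne hf]) (by simp)]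
  simp

/-- The parity of the number of edges of `F` among the first `l` edges of strip `j`. -/
def stripCount {n : ℕ} (j l : ℕ) (F : Fin n × Fin n → ZMod 2) : ZMod 2 :=
  ∑ e : Fin n × Fin n, if e.2.val = j ∧ e.1.val < l then F e else 0

/-- The sign character of `ZMod 2`. -/
noncomputable def paritySign (z : ZMod 2) : ℝ := if z = 0 then 1 else -1

@[simp] lemma paritySign_zero : paritySign 0 = 1 := by simp [paritySign]

@[simp] lemma paritySign_add_one (z : ZMod 2) : paritySign (z + 1) = -paritySign z := by
  have : z + 1 = 0 ↔ z ≠ 0 := by revert z; decide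
  unfold paritySign; simp only [this]; split_ifs <;> simp_all

lemma abs_paritySign (z : ZMod 2) : |paritySign z| = 1 := by
  unfold paritySign; split_ifs <;> simp

open Classical in
/-- The generating function of edge sets with boundary `A`, signed by the parity of
the number of edges among the first `l` edges of strip `j`. -/
noncomputable def signedSum (κ : ℕ) {n : ℕ} (y : Fin n × Fin n → ℝ) (j l : ℕ)
    (A : ℕ × ℕ → ZMod 2) : ℝ :=
  ∑ F, if boundary κ n F = A then chainWeight y F * paritySign (stripCount j l F) else 0

variable {κ n : ℕ} {y : Fin n × Fin n → ℝ}

lemma sum_eq_sum_toggle {ε : Type*} [Fintype ε] [DecidableEq ε] (e : ε)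
    (f : (ε → ZMod 2) → ℝ) :
    ∑ F, f F = ∑ F : ε → ZMod 2, if F e = 0 then f F + f (F + Pi.single e 1) else 0 := by
  have h : ∑ F : ε → ZMod 2, (if F e = 0 then 0 else f F) =
      ∑ F : ε → ZMod 2, if F e = 0 then f (F + Pi.single e 1) else 0 := by
    rw [← Equiv.sum_comp (Equiv.addRight (Pi.single e 1 : ε → ZMod 2))]
    refine sum_congr rfl fun F _ => ?_
    have : ∀ z : ZMod 2, z + 1 = 0 ↔ z ≠ 0 := by decide
    simp only [Equiv.coe_addRight, Pi.add_apply, Pi.single_eq_same, this]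
    split_ifs <;> simp_all
  calc ∑ F, f F = ∑ F : ε → ZMod 2, ((if F e = 0 then f F else 0) + if F e = 0 then 0 else f F) :=
        sum_congr rfl fun F _ => by split_ifs <;> simp
    _ = _ := by
        rw [sum_add_distrib, h, ← sum_add_distrib]
        exact sum_congr rfl fun F _ => by split_ifs <;> simp

lemma chainWeight_add_single {ε : Type*} [Fintype ε] [DecidableEq ε] (y : ε → ℝ) {e : ε}
    {F : ε → ZMod 2} (h : F e = 0) :
    chainWeight y (F + Pi.single e 1) = y e * chainWeight y F := by
  unfold chainWeight
  rw [Fintype.prod_eq_mul_prod_compl e, Fintype.prod_eq_mul_prod_compl e]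
  simp only [Pi.add_apply, h, Pi.single_eq_same, zero_add, one_ne_zero, if_false, if_true, one_mul]
  congr 1
  refine prod_congr rfl fun f hf => ?_
  have : f ≠ e := by simpa using hf
  simp [this]

lemma stripCount_add_single (j l : ℕ) (F : Fin n × Fin n → ZMod 2) (e : Fin n × Fin n) :
    stripCount j l (F + Pi.single e 1) =
      stripCount j l F + if e.2.val = j ∧ e.1.val < l then 1 else 0 := by
  unfold stripCount
  have : ∀ f : Fin n × Fin n, (if f.2.val = j ∧ f.1.val < l then
      (F + Pi.single e 1 : Fin n × Fin n → ZMod 2) f else 0) =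
      (if f.2.val = j ∧ f.1.val < l then F f else 0) +
      if f.2.val = j ∧ f.1.val < l then (Pi.single e 1 : Fin n × Fin n → ZMod 2) f else 0 := by
    intro f; split_ifs <;> simp
  rw [sum_congr rfl fun f _ => this f, sum_add_distrib]
  congr 1
  rw [sum_eq_single e (fun f _ hf => by simp [Pi.single_eq_of_ne hf]) (by simp)]
  simp

lemma stripCount_succ {i j : Fin n} (F : Fin n × Fin n → ZMod 2) (h : F (i, j) = 0) :
    stripCount j (i + 1) F = stripCount j i F := by
  refine sum_congr rfl fun e _ => ?_
  by_cases he : e = (i, j)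
  · subst he; simp [h]
  · have : ¬ (e.2.val = j ∧ e.1.val = i) := by
      rintro ⟨h1, h2⟩
      exact he (Prod.ext (Fin.ext h2) (Fin.ext h1))
    refine if_congr ?_ rfl rfl
    omega

open Classical in
lemma signedSum_toggle (y : Fin n × Fin n → ℝ) (i j : Fin n) (l : ℕ) (A : ℕ × ℕ → ZMod 2) :
    signedSum κ y j l A =
      (∑ F : Fin n × Fin n → ZMod 2, if F (i, j) = 0 ∧ boundary κ n F = A then
          chainWeight y F * paritySign (stripCount j l F) else 0) +
      y (i, j) * (if i.val < l then -1 else 1) *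
        ∑ F : Fin n × Fin n → ZMod 2, if F (i, j) = 0 ∧ boundary κ n F =
            A + site (zigzag κ j i) + site (zigzag κ j (i + 1)) then
          chainWeight y F * paritySign (stripCount j l F) else 0 := by
  unfold signedSum
  rw [sum_eq_sum_toggle (i, j), mul_sum, ← sum_add_distrib]
  refine sum_congr rfl fun F _ => ?_
  by_cases hF : F (i, j) = 0
  · have hb : boundary κ n (F + Pi.single (i, j) 1) = A ↔
        boundary κ n F = A + site (zigzag κ j i) + site (zigzag κ j (i + 1)) := by
      rw [map_add, boundary_single, add_assoc A]
      constructor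
      · intro h
        rw [← h, add_assoc, add_add_add_comm, site_add_self, site_add_self]; simp
      · intro h
        rw [h, add_assoc, add_add_add_comm, site_add_self, site_add_self]; simp
    rw [if_pos hF]
    simp only [hF, true_and, hb, chainWeight_add_single y hF, stripCount_add_single]
    congr 1
    by_cases hl : i.val < l <;> split_ifs <;> simp <;> ring
  · simp [hF]

open Classical in
/-- The linear relations between the site values at the two ends of an edge. -/
lemma signedSum_edge (i j : Fin n) (t : ℕ × ℕ → ZMod 2) :
    (1 + y (i, j) ^ 2) * signedSum κ y j (i + 1) (t + site (zigzag κ j i)) =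
      (1 - y (i, j) ^ 2) * signedSum κ y j i (t + site (zigzag κ j i)) -
        2 * y (i, j) * signedSum κ y j (i + 1) (t + site (zigzag κ j (i + 1))) ∧
    (1 + y (i, j) ^ 2) * signedSum κ y j i (t + site (zigzag κ j (i + 1))) =
      2 * y (i, j) * signedSum κ y j i (t + site (zigzag κ j i)) +
        (1 - y (i, j) ^ 2) * signedSum κ y j (i + 1) (t + site (zigzag κ j (i + 1))) := by
  have hcount : ∀ A : ℕ × ℕ → ZMod 2,
      (∑ F : Fin n × Fin n → ZMod 2, if F (i, j) = 0 ∧ boundary κ n F = A then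
          chainWeight y F * paritySign (stripCount j (i + 1) F) else 0) =
      ∑ F : Fin n × Fin n → ZMod 2, if F (i, j) = 0 ∧ boundary κ n F = A then
          chainWeight y F * paritySign (stripCount j i F) else 0 := by
    intro A
    refine sum_congr rfl fun F _ => ?_
    by_cases hF : F (i, j) = 0
    · rw [stripCount_succ F hF]
    · simp [hF]
  have h1 : t + site (zigzag κ j i) + site (zigzag κ j i) + site (zigzag κ j (i + 1)) =
      t + site (zigzag κ j (i + 1)) := by
    rw [add_assoc t, site_add_self, add_zero]
  have h2 : t + site (zigzag κ j (i + 1)) + site (zigzag κ j i) + site (zigzag κ j (i + 1)) =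
      t + site (zigzag κ j i) := by
    rw [add_right_comm, add_assoc t, site_add_self, add_zero]
  have e1 := signedSum_toggle (κ := κ) y i j (i + 1) (t + site (zigzag κ j i))
  have e2 := signedSum_toggle (κ := κ) y i j i (t + site (zigzag κ j i))
  have e3 := signedSum_toggle (κ := κ) y i j (i + 1) (t + site (zigzag κ j (i + 1)))
  have e4 := signedSum_toggle (κ := κ) y i j i (t + site (zigzag κ j (i + 1)))
  rw [hcount, hcount, h1] at e1
  rw [h1] at e2
  rw [hcount, hcount, h2] at e3
  rw [h2] at e4
  simp only [Nat.lt_succ_self, if_true, lt_irrefl, if_false] at e1 e2 e3 e4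
  rw [e1, e2, e3, e4]
  constructor <;> ring

/-- The parity count of two adjacent strips is local at the sites between them. -/
lemma stripCount_add_stripCount (F : Fin n × Fin n → ZMod 2) {j p : ℕ}
    (hp : (p + (j + 1) + κ) % 2 = 0) :
    stripCount j (p + 1) F + stripCount (j + 1) (p + 1) F =
      stripCount j (p - 1) F + stripCount (j + 1) (p - 1) F + boundary κ n F (p, j + 1) := by
  unfold stripCount
  rw [boundary_apply, ← sum_add_distrib, ← sum_add_distrib, ← sum_add_distrib]
  refine sum_congr rfl fun e _ => ?_
  simp only [site, zigzag, Prod.mk.injEq]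
  have h1 : (p = e.1.val ∧ j + 1 = e.2.val + (e.1.val + e.2.val + κ) % 2) ↔
      (e.1.val = p ∧ (e.2.val = j ∨ e.2.val = j + 1)) := by omega
  have h2 : (p = e.1.val + 1 ∧ j + 1 = e.2.val + (e.1.val + 1 + e.2.val + κ) % 2) ↔
      (e.1.val + 1 = p ∧ (e.2.val = j ∨ e.2.val = j + 1)) := by omega
  simp only [h1, h2]
  by_cases a1 : e.2.val = j
  · have a2 : ¬ j = j + 1 := by omega
    simp only [a1, a2, true_and, false_and, true_or, and_true, if_false, add_zero]
    rcases lt_trichotomy e.1.val p with h | h | h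
    · by_cases h' : e.1.val + 1 = p
      · have : ¬ e.1.val < p - 1 := by omega
        have h3 : e.1.val < p + 1 := by omega
        have h4 : ¬ e.1.val = p := by omega
        simp [*]
      · have : e.1.val < p - 1 := by omega
        have h3 : e.1.val < p + 1 := by omega
        have h4 : ¬ e.1.val = p := by omega
        simp [*]
    · have : ¬ e.1.val < p - 1 := by omega
      simp [h]
    · have : ¬ e.1.val < p - 1 := by omega
      have h3 : ¬ e.1.val < p + 1 := by omega
      have h4 : ¬ e.1.val = p := by omega
      have h5 : ¬ e.1.val + 1 = p := by omega
      simp only [*, if_false]; simp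
  · by_cases a2 : e.2.val = j + 1
    · have a3 : ¬ j + 1 = j := by omega
      simp only [a2, a3, true_and, false_and, or_true, and_true, if_false, zero_add]
      rcases lt_trichotomy e.1.val p with h | h | h
      · by_cases h' : e.1.val + 1 = p
        · have : ¬ e.1.val < p - 1 := by omega
          have h3 : e.1.val < p + 1 := by omega
          have h4 : ¬ e.1.val = p := by omega
          simp [*]
        · have : e.1.val < p - 1 := by omega
          have h3 : e.1.val < p + 1 := by omega
          have h4 : ¬ e.1.val = p := by omega
          simp [*]
      · have : ¬ e.1.val < p - 1 := by omega
        simp [h]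
      · have : ¬ e.1.val < p - 1 := by omega
        have h3 : ¬ e.1.val < p + 1 := by omega
        have h4 : ¬ e.1.val = p := by omega
        have h5 : ¬ e.1.val + 1 = p := by omega
        simp only [*, if_false]; simp
    · simp [a1, a2]

end Zigzag

section ZigzagSigns

variable {κ n : ℕ} {y : Fin n × Fin n → ℝ}

lemma sum_site (s : Finset (ℕ × ℕ)) (w : ℕ × ℕ) :
    ∑ u ∈ s, site w u = if w ∈ s then 1 else 0 := by
  simp [site]

/-- The total boundary in the rows up to `j` is the parity of strip `j`. -/
lemma sum_boundary_rows (F : Fin n × Fin n → ZMod 2) (j : ℕ) :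
    ∑ u ∈ range (n + 1) ×ˢ range (j + 1), boundary κ n F u = stripCount j n F := by
  simp only [boundary_apply]
  rw [sum_comm]
  refine sum_congr rfl fun e _ => ?_
  rw [← mul_sum, sum_add_distrib, sum_site, sum_site]
  have h1 : zigzag κ e.2 e.1 ∈ range (n + 1) ×ˢ range (j + 1) ↔
      e.2.val + (e.1.val + e.2.val + κ) % 2 ≤ j := by
    simp [zigzag]
  have h2 : zigzag κ e.2 (e.1 + 1) ∈ range (n + 1) ×ˢ range (j + 1) ↔
      e.2.val + (e.1.val + 1 + e.2.val + κ) % 2 ≤ j := by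
    simp [zigzag]
  simp only [h1, h2]
  rcases lt_trichotomy e.2.val j with h | h | h
  · rw [if_pos (by omega), if_pos (by omega), if_neg (by omega), CharTwo.add_self_eq_zero,
      mul_zero]
  · rcases Nat.mod_two_eq_zero_or_one (e.1.val + e.2.val + κ) with h' | h'
    · rw [if_pos (by omega), if_neg (by omega), if_pos (by omega)]; simp
    · rw [if_neg (by omega), if_pos (by omega), if_pos (by omega)]; simp
  · rw [if_neg (by omega), if_neg (by omega), if_neg (by omega)]; simp

lemma stripCount_last_succ (F : Fin n × Fin n → ZMod 2) (j : ℕ) :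
    stripCount j (n + 1) F = stripCount j n F :=
  sum_congr rfl fun e _ => if_congr (by omega) rfl rfl

lemma stripCount_zero (F : Fin n × Fin n → ZMod 2) (j : ℕ) : stripCount j 0 F = 0 := by
  simp [stripCount]

lemma stripCount_of_le (F : Fin n × Fin n → ZMod 2) {j : ℕ} (hj : n ≤ j) (l : ℕ) :
    stripCount j l F = 0 :=
  sum_eq_zero fun e _ => if_neg (by omega)

lemma stripCount_add_stripCount_pred (F : Fin n × Fin n → ZMod 2) {j i : ℕ}
    (hi : (i + (j + 1) + κ) % 2 = 0) (h : ∀ p < i, boundary κ n F (p, j + 1) = 0) :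
    stripCount j (i - 1) F + stripCount (j + 1) (i - 1) F = 0 := by
  induction i using Nat.strong_induction_on with
  | _ i ih =>
    rcases i with _ | _ | i
    · simp [stripCount_zero]
    · simp [stripCount_zero]
    · have := stripCount_add_stripCount F (p := i) (j := j) (κ := κ) (by omega)
      rw [ih i (by omega) (by omega) (fun p hp => h p (by omega)), h i (by omega), zero_add] at this
      exact this

lemma signedSum_congr_count {j j' l l' : ℕ} {A : ℕ × ℕ → ZMod 2}
    (h : ∀ F : Fin n × Fin n → ZMod 2, boundary κ n F = A →
      stripCount j l F = stripCount j' l' F) :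
    signedSum κ y j l A = signedSum κ y j' l' A := by
  classical
  refine sum_congr rfl fun F _ => ?_
  by_cases hF : boundary κ n F = A
  · rw [if_pos hF, if_pos hF, h F hF]
  · rw [if_neg hF, if_neg hF]

lemma signedSum_neg_count {j j' l l' : ℕ} {A : ℕ × ℕ → ZMod 2}
    (h : ∀ F : Fin n × Fin n → ZMod 2, boundary κ n F = A →
      stripCount j l F = stripCount j' l' F + 1) :
    signedSum κ y j l A = -signedSum κ y j' l' A := by
  classical
  unfold signedSum
  rw [← sum_neg_distrib]
  refine sum_congr rfl fun F _ => ?_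
  by_cases hF : boundary κ n F = A
  · rw [if_pos hF, if_pos hF, h F hF, paritySign_add_one, mul_neg]
  · rw [if_neg hF, if_neg hF, neg_zero]

lemma signedSum_eq_cosetSum {j l : ℕ} {A : ℕ × ℕ → ZMod 2}
    (h : ∀ F : Fin n × Fin n → ZMod 2, boundary κ n F = A → chainWeight y F ≠ 0 →
      stripCount j l F = 0) :
    signedSum κ y j l A = cosetSum (boundary κ n) ⊥ y A := by
  refine sum_congr rfl fun F _ => ?_
  by_cases hF : boundary κ n F = A
  · by_cases h0 : chainWeight y F = 0
    · simp [h0]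
    · simp [hF, h F hF h0]
  · rw [if_neg hF, if_neg (by simpa [AddSubgroup.mem_bot, sub_eq_zero] using hF)]

lemma abs_signedSum_le (hy : ∀ e, 0 ≤ y e) (j l : ℕ) (A : ℕ × ℕ → ZMod 2) :
    |signedSum κ y j l A| ≤ cosetSum (boundary κ n) ⊥ y A := by
  refine (abs_sum_le_sum_abs _ _).trans (sum_le_sum fun F _ => ?_)
  by_cases hF : boundary κ n F = A
  · rw [if_pos hF, if_pos (by simp [hF]), abs_mul, abs_paritySign, mul_one,
      abs_of_nonneg (chainWeight_nonneg hy F)]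
  · rw [if_neg hF, if_neg (by simpa [AddSubgroup.mem_bot, sub_eq_zero] using hF), abs_zero]

/-- The indicator that the `i`-th site of the zigzag path lies on the lower boundary
of the strip. -/
noncomputable def lowerSite (κ j i : ℕ) : ℝ := if (i + j + κ) % 2 = 0 then 1 else 0

lemma one_sub_lowerSite (κ j i : ℕ) :
    1 - lowerSite κ j i = if (i + j + κ) % 2 = 0 then 0 else 1 := by
  unfold lowerSite; split_ifs <;> simp

lemma lowerSite_succ_right (κ j i : ℕ) : lowerSite κ j (i + 1) = 1 - lowerSite κ j i := by
  rw [one_sub_lowerSite]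
  unfold lowerSite
  split_ifs <;> first | rfl | (exfalso; omega)

lemma lowerSite_succ_left (κ j i : ℕ) : lowerSite κ (j + 1) i = 1 - lowerSite κ j i := by
  rw [one_sub_lowerSite]
  unfold lowerSite
  split_ifs <;> first | rfl | (exfalso; omega)

lemma signedSum_zero_nonneg (hy : ∀ e, 0 ≤ y e) (j : ℕ) (A : ℕ × ℕ → ZMod 2) :
    0 ≤ signedSum κ y j 0 A := by
  rw [signedSum_eq_cosetSum fun F _ _ => stripCount_zero F j]
  exact cosetSum_nonneg _ _ hy _

lemma stripCount_last {t w : ℕ × ℕ} {j : ℕ} (ht1 : t.1 ≤ n) (ht2 : t.2 ≤ j) (hw : w.1 ≤ n)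
    {F : Fin n × Fin n → ZMod 2} (hF : boundary κ n F = site t + site w) :
    stripCount j n F = 1 + if w.2 ≤ j then 1 else 0 := by
  rw [← sum_boundary_rows (κ := κ), hF]
  simp only [Pi.add_apply]
  rw [sum_add_distrib, sum_site, sum_site, if_pos (by simp; omega)]
  congr 1
  refine if_congr ?_ rfl rfl
  simp; omega

/-- The strip relations for the signed sums. -/
lemma stripData_signedSum {x : ℕ → ℝ} (hx : ∀ j, 0 ≤ x j) {t : ℕ × ℕ} {j : ℕ}
    (ht1 : t.1 ≤ n) (ht2 : t.2 ≤ j) (hj : j < n ∨ x j = 0) :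
    StripData n (x j) (lowerSite κ j)
      (fun i => signedSum κ (fun e : Fin n × Fin n => x e.2) j i (site t + site (zigzag κ j i)))
      (fun i => signedSum κ (fun e : Fin n × Fin n => x e.2) j (i - 1)
        (site t + site (zigzag κ j i)))
      (fun i => signedSum κ (fun e : Fin n × Fin n => x e.2) j (i + 1)
        (site t + site (zigzag κ j i))) := by
  have hy : ∀ e : Fin n × Fin n, 0 ≤ x e.2 := fun e => hx _
  have hl0 : ∀ i, 0 ≤ lowerSite κ j i := fun i => by unfold lowerSite; split_ifs <;> simp
  have hl1 : ∀ i, 0 ≤ 1 - lowerSite κ j i := fun i => by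
    rw [one_sub_lowerSite]; split_ifs <;> simp
  have htriv : n ≤ j → ∀ l l' A, signedSum κ (fun e : Fin n × Fin n => x e.2) j l A =
      signedSum κ (fun e : Fin n × Fin n => x e.2) j l' A := fun h l l' A =>
    signedSum_congr_count fun F _ => by rw [stripCount_of_le F h, stripCount_of_le F h]
  refine ⟨lowerSite_succ_right κ j, fun i hi => ?_, fun i hi => ?_, rfl, ?_,
    mul_nonneg (hl0 0) (signedSum_zero_nonneg hy _ _),
    mul_nonneg (hl1 0) (signedSum_zero_nonneg hy _ _), ?_, ?_⟩
  · by_cases h : j < n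
    · exact (signedSum_edge (y := fun e : Fin n × Fin n => x e.2) ⟨i, hi⟩ ⟨j, h⟩ (site t)).1
    · rw [hj.resolve_left h, htriv (not_lt.1 h) (i + 1) i]; ring
  · by_cases h : j < n
    · exact (signedSum_edge (y := fun e : Fin n × Fin n => x e.2) ⟨i, hi⟩ ⟨j, h⟩ (site t)).2
    · rw [hj.resolve_left h, htriv (not_lt.1 h) (i + 1) (i + 1 - 1)]; ring
  · exact signedSum_congr_count fun F _ => stripCount_last_succ F j
  · unfold lowerSite
    split_ifs with h
    · rw [one_mul, signedSum_eq_cosetSum]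
      · exact cosetSum_nonneg _ _ hy _
      · intro F hF _
        rw [stripCount_last ht1 ht2 (by simp [zigzag]) hF, if_pos (by simp [zigzag]; omega)]
        decide
    · simp
  · rw [one_sub_lowerSite]
    split_ifs with h
    · simp
    · rw [one_mul, signedSum_neg_count (j' := j) (l' := 0), Left.neg_nonpos_iff]
      · exact signedSum_zero_nonneg hy _ _
      · intro F hF
        rw [stripCount_last ht1 ht2 (by simp [zigzag]) hF, if_neg (by simp [zigzag]; omega),
          stripCount_zero]
        decide

/-- Passing through a site between two strips. -/
lemma signedSum_next_strip {t : ℕ × ℕ} {j i : ℕ} (ht : t.2 ≤ j) (hi : (i + (j + 1) + κ) % 2 = 0) :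
    zigzag κ j i = zigzag κ (j + 1) i ∧
    signedSum κ y (j + 1) (i - 1) (site t + site (zigzag κ (j + 1) i)) =
      signedSum κ y j (i - 1) (site t + site (zigzag κ j i)) ∧
    signedSum κ y (j + 1) (i + 1) (site t + site (zigzag κ (j + 1) i)) =
      -signedSum κ y j (i + 1) (site t + site (zigzag κ j i)) := by
  have hz : zigzag κ j i = (i, j + 1) := by simp [zigzag]; omega
  have hz' : zigzag κ (j + 1) i = (i, j + 1) := by simp [zigzag]; omega
  rw [hz, hz']
  have hpred : ∀ F : Fin n × Fin n → ZMod 2, boundary κ n F = site t + site (i, j + 1) →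
      stripCount j (i - 1) F + stripCount (j + 1) (i - 1) F = 0 := by
    intro F hF
    refine stripCount_add_stripCount_pred F hi fun p hp => ?_
    rw [hF]
    simp only [Pi.add_apply, site]
    rw [if_neg, if_neg, add_zero]
    · simp; omega
    · rintro rfl; simp at ht
  have add_eq : ∀ a b c : ZMod 2, a + b = c → b = a + c := by decide
  refine ⟨rfl, signedSum_congr_count fun F hF => ?_, signedSum_neg_count fun F hF => ?_⟩
  · simpa using add_eq _ _ _ (hpred F hF)
  · have := stripCount_add_stripCount F hi
    rw [hpred F hF, hF, zero_add] at this
    simp only [Pi.add_apply, site] at this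
    rw [if_neg (by rintro rfl; simp at ht), if_pos trivial, zero_add] at this
    exact add_eq _ _ _ this

/-- Two-point functions of the free-boundary zigzag system decay geometrically in
the number of strips. -/
theorem cosetSum_strips_le {x₀ μ : ℝ} (hx0 : 0 ≤ x₀) (hx1 : x₀ < 1) (hμ : 2 * x₀ ≤ μ * (1 - x₀ ^ 2))
    {j₀ j₁ p q : ℕ} (hj : j₀ ≤ j₁) (hjn : j₁ ≤ n) (hp : p ≤ n) (hq : q ≤ n)
    (hpar : (p + j₁ + κ) % 2 = 0) :
    cosetSum (boundary κ n) ⊥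
        (fun e : Fin n × Fin n => if j₀ ≤ e.2.val ∧ e.2.val < j₁ then x₀ else 0)
        (site (q, j₀) + site (p, j₁)) ≤
      (n + 1) * μ ^ (j₁ - j₀) * cosetSum (boundary κ n) ⊥
        (fun e : Fin n × Fin n => if j₀ ≤ e.2.val ∧ e.2.val < j₁ then x₀ else 0) 0 := by
  set x : ℕ → ℝ := fun j => if j₀ ≤ j ∧ j < j₁ then x₀ else 0 with hxdef
  have hx : ∀ j, 0 ≤ x j := fun j => by simp only [hxdef]; split_ifs <;> simp [hx0]
  have hx1' : ∀ j, x j ≤ 1 := fun j => by simp only [hxdef]; split_ifs <;> simp [hx1.le]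
  change cosetSum (boundary κ n) ⊥ (fun e : Fin n × Fin n => x e.2) _ ≤
    _ * cosetSum (boundary κ n) ⊥ (fun e : Fin n × Fin n => x e.2) 0
  set y : Fin n × Fin n → ℝ := fun e => x e.2 with hydef
  set Z := cosetSum (boundary κ n) ⊥ y 0 with hZ
  have hy : ∀ e, 0 ≤ y e := fun e => hx _
  have hy1 : ∀ e, y e ≤ 1 := fun e => hx1' _
  have hZ0 : 0 < Z := cosetSum_zero_pos _ _ hy
  have hd : 0 < 1 - x₀ ^ 2 := by nlinarith
  have hμ0 : 0 ≤ μ := by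
    by_contra h
    nlinarith [mul_pos (neg_pos.2 (not_le.1 h)) hd]
  have hμ2 : 2 * x₀ ≤ μ := by nlinarith [mul_nonneg hμ0 (sq_nonneg x₀)]
  set a : ℕ → ℕ → ℝ := fun j i => signedSum κ y j i (site (q, j₀) + site (zigzag κ j i)) with ha
  set U : ℕ → ℝ := fun j => ∑ i ∈ range (n + 1), lowerSite κ j i * a j i with hU
  have hdata : ∀ j, j₀ ≤ j → j ≤ j₁ → StripData n (x j) (lowerSite κ j) (a j) _ _ :=
    fun j h1 h2 => stripData_signedSum (κ := κ) hx (t := (q, j₀)) hq h1 (by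
      rcases h2.lt_or_eq with h | h
      · left; omega
      · right; simp [hxdef, h])
  have hstep : ∀ j, j₀ ≤ j → j < j₁ →
      (1 + x j ^ 2) * ((1 - x (j + 1) ^ 2) * U (j + 1) + x (j + 1) ^ 2 *
        (lowerSite κ (j + 1) 0 * a (j + 1) 0 + lowerSite κ (j + 1) n * a (j + 1) n)) ≤
      (1 + x (j + 1) ^ 2) * (2 * x j * U j + x j ^ 2 *
        (lowerSite κ (j + 1) 0 * a (j + 1) 0 + lowerSite κ (j + 1) n * a (j + 1) n)) := by
    intro j h1 h2
    have hd' := hdata (j + 1) (by omega) (by omega)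
    have hfun : lowerSite κ (j + 1) = fun i => 1 - lowerSite κ j i :=
      funext fun i => lowerSite_succ_left κ j i
    rw [hfun] at hd'
    have := (hdata j h1 h2.le).transfer (hx j) (hx (j + 1)) hd' (fun i _ => ?_) (fun i _ => ?_)
    · simpa only [hU, lowerSite_succ_left] using this
    · rw [one_sub_lowerSite]
      split_ifs with h
      · simp
      · rw [(signedSum_next_strip (t := (q, j₀)) h1 (by omega)).2.1]
    · rw [one_sub_lowerSite]
      split_ifs with h
      · simp
      · rw [(signedSum_next_strip (t := (q, j₀)) h1 (by omega)).2.2]; simp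
  have habs : ∀ j i, lowerSite κ j i * a j i ≤ Z := fun j i => by
    have h1 : a j i ≤ Z := (le_abs_self _).trans
      ((abs_signedSum_le hy _ _ _).trans (cosetSum_le_zero _ _ hy hy1 _))
    unfold lowerSite; split_ifs <;> simp [h1, hZ0.le]
  have hbase : U j₀ ≤ (n + 1) * Z := by
    refine (sum_le_card_nsmul _ _ Z fun i _ => habs j₀ i).trans ?_
    simp
  have hiter : ∀ j, j₀ ≤ j → j < j₁ → U j ≤ (n + 1) * μ ^ (j - j₀) * Z := by
    intro j h1
    induction j, h1 using Nat.le_induction with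
    | base => intro _; simpa using hbase
    | succ j h1 ih =>
      intro h2
      have := hstep j h1 (by omega)
      have e1 : x j = x₀ := by simp only [hxdef]; rw [if_pos]; omega
      have e2 : x (j + 1) = x₀ := by simp only [hxdef]; rw [if_pos]; omega
      rw [e1, e2] at this
      have h3 : (1 - x₀ ^ 2) * U (j + 1) ≤ 2 * x₀ * U j := by
        have hpos : (0 : ℝ) < 1 + x₀ ^ 2 := by positivity
        have := le_of_mul_le_mul_left this hpos
        linarith
      have h4 := ih (by omega)
      have hC : 0 ≤ (n + 1) * μ ^ (j - j₀) * Z := by positivity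
      have h5 : (1 - x₀ ^ 2) * U (j + 1) ≤
          (1 - x₀ ^ 2) * (μ * ((n + 1) * μ ^ (j - j₀) * Z)) := by
        nlinarith [mul_le_mul_of_nonneg_left h4 hx0, mul_le_mul_of_nonneg_right hμ hC]
      have h6 := le_of_mul_le_mul_left h5 hd
      rw [show j + 1 - j₀ = (j - j₀) + 1 by omega, pow_succ]
      linarith
  rcases hj.eq_or_lt with rfl | hlt
  · refine (cosetSum_le_zero _ _ hy hy1 _).trans ?_
    simp only [Nat.sub_self, pow_zero, mul_one]
    nlinarith [Nat.cast_nonneg (α := ℝ) n]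
  · have htop : ∀ i, a j₁ i = cosetSum (boundary κ n) ⊥ y
        (site (q, j₀) + site (zigzag κ j₁ i)) := by
      intro i
      refine signedSum_eq_cosetSum fun F _ h0 => sum_eq_zero fun e _ => ?_
      split_ifs with he
      · by_contra hF
        refine h0 (prod_eq_zero (mem_univ e) ?_)
        rw [if_neg hF]
        simp [hydef, hxdef, he.1]
      · rfl
    have ha0 : ∀ i, 0 ≤ lowerSite κ j₁ i * a j₁ i := fun i => by
      rw [htop]
      refine mul_nonneg ?_ (cosetSum_nonneg _ _ hy _)
      unfold lowerSite; split_ifs <;> simp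
    obtain ⟨j, rfl⟩ : ∃ j, j₁ = j + 1 := ⟨j₁ - 1, by omega⟩
    have h1 := hstep j (by omega) (by omega)
    have e1 : x j = x₀ := by simp only [hxdef]; rw [if_pos]; omega
    have e2 : x (j + 1) = 0 := by simp [hxdef]
    have hE : lowerSite κ (j + 1) 0 * a (j + 1) 0 + lowerSite κ (j + 1) n * a (j + 1) n ≤
        U (j + 1) := by
      have h0n : (0 : ℕ) ≠ n := by omega
      calc _ = ∑ i ∈ {0, n}, lowerSite κ (j + 1) i * a (j + 1) i := (sum_pair h0n).symm
        _ ≤ U (j + 1) := sum_le_sum_of_subset_of_nonneg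
            (by intro i; simp; omega) fun i _ _ => ha0 i
    have hle : cosetSum (boundary κ n) ⊥ y (site (q, j₀) + site (p, j + 1)) ≤ U (j + 1) := by
      have hz : zigzag κ (j + 1) p = (p, j + 1) := by simp [zigzag]; omega
      have := single_le_sum (f := fun i => lowerSite κ (j + 1) i * a (j + 1) i)
        (fun i _ => ha0 i) (mem_range.2 (Nat.lt_succ_of_le hp))
      rw [htop, hz, lowerSite, if_pos hpar, one_mul] at this
      exact this
    refine hle.trans ?_
    rw [e1, e2] at h1
    have h2 : U (j + 1) ≤ 2 * x₀ * U j := by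
      nlinarith [mul_le_mul_of_nonneg_left hE (sq_nonneg x₀)]
    have h4 : U j ≤ (n + 1) * μ ^ (j - j₀) * Z := hiter j (by omega) (by omega)
    have hC : 0 ≤ (n + 1) * μ ^ (j - j₀) * Z := by positivity
    rw [show j + 1 - j₀ = (j - j₀) + 1 by omega, pow_succ]
    nlinarith [mul_le_mul_of_nonneg_left h4 hx0, mul_le_mul_of_nonneg_right hμ2 hC]

end ZigzagSigns

section Crossing

variable {κ n : ℕ}

open Classical in
lemma sum_containsChain_le {ε V : Type*} [Fintype ε] [DecidableEq ε] [AddCommGroup V]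
    (bd : (ε → ZMod 2) →+ V) (S : AddSubgroup V)
    {y y' : ε → ℝ} {D : ε → Prop} (hy : ∀ e, 0 ≤ y e) (hy' : ∀ e, 0 ≤ y' e)
    (hyy' : ∀ e, D e → y e ≤ y' e) (hy1 : ∀ e, y e * y' e ≤ 1) (A B : V)
    {g : (ε → ZMod 2) → ℝ} (hg : ∀ F, 0 ≤ g F)
    (hgD : ∀ F K, (∀ e, K e ≠ 0 → D e) → g (F + K) = g F) {C : ℝ}
    (hC : cosetSum bd ⊥ y' B ≤ C * cosetSum bd ⊥ y' 0) :
    (∑ F, if bd F - A ∈ S ∧ ContainsChain bd D B F then chainWeight y F * g F else 0) ≤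
      C * ∑ F, if bd F - (A + B) ∈ S then chainWeight y F * g F else 0 := by
  have h := switching_containsChain bd S hy hy' hyy' hy1 A B hg hgD
  have hpos := cosetSum_zero_pos bd ⊥ hy'
  have hnn : 0 ≤ ∑ F, if bd F - (A + B) ∈ S then chainWeight y F * g F else 0 :=
    sum_nonneg fun F _ => by
      split_ifs
      · exact mul_nonneg (chainWeight_nonneg hy F) (hg F)
      · exact le_rfl
  refine le_of_mul_le_mul_right (h.trans ?_) hpos
  calc _ ≤ (∑ F, if bd F - (A + B) ∈ S then chainWeight y F * g F else 0) *
        (C * cosetSum bd ⊥ y' 0) := mul_le_mul_of_nonneg_left hC hnn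
    _ = _ := by ring

/-- Site functions vanishing at the interior sites of the `n × n` square. -/
def boundarySupported (n : ℕ) : AddSubgroup (ℕ × ℕ → ZMod 2) where
  carrier := {f | ∀ p q, 0 < p → p < n → 0 < q → q < n → f (p, q) = 0}
  zero_mem' := by simp
  add_mem' := by
    intro f g hf hg p q h1 h2 h3 h4
    simp [hf p q h1 h2 h3 h4, hg p q h1 h2 h3 h4]
  neg_mem' := by
    intro f hf p q h1 h2 h3 h4
    simp [hf p q h1 h2 h3 h4]

/-- `F` contains a chain from the top row `n` down to row `k + 1`, and a chain from
row `k` down to row `0`, with prescribed end points. -/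
def CrossesAt (κ : ℕ) {n : ℕ} (F : Fin n × Fin n → ZMod 2) (k s v v' t : ℕ) : Prop :=
  ContainsChain (boundary κ n) (fun e => k + 1 ≤ e.2.val) (site (s, n) + site (v, k + 1)) F ∧
    ContainsChain (boundary κ n) (fun e => e.2.val < k) (site (v', k) + site (t, 0)) F

open Classical in
theorem sum_crossesAt_le {y : Fin n × Fin n → ℝ} {x₀ μ : ℝ} (hy : ∀ e, 0 ≤ y e)
    (hyx : ∀ e, y e ≤ x₀) (hx1 : x₀ < 1) (hμ : 2 * x₀ ≤ μ * (1 - x₀ ^ 2))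
    {k s v v' t : ℕ} (hk : k < n) (hs : s ≤ n) (hv : v ≤ n) (hv' : v' ≤ n) (ht : t ≤ n)
    (hsp : (s + n + κ) % 2 = 0) (hvp : (v' + k + κ) % 2 = 0) :
    (∑ F : Fin n × Fin n → ZMod 2, if boundary κ n F ∈ boundarySupported n ∧
        CrossesAt κ F k s v v' t then chainWeight y F else 0) ≤
      (n + 1) ^ 2 * μ ^ (n - 1) * cosetSum (boundary κ n) (boundarySupported n) y 0 := by
  have hx0 : 0 ≤ x₀ := (hy (⟨k, hk⟩, ⟨k, hk⟩)).trans (hyx _)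
  have hd : 0 < 1 - x₀ ^ 2 := by nlinarith
  have hμ0 : 0 ≤ μ := by
    by_contra h
    nlinarith [mul_pos (neg_pos.2 (not_le.1 h)) hd]
  have hy1 : ∀ e, y e ≤ 1 := fun e => (hyx e).trans hx1.le
  have hstrip : ∀ (j₀ j₁ : ℕ) (e : Fin n × Fin n),
      0 ≤ (if j₀ ≤ e.2.val ∧ e.2.val < j₁ then x₀ else 0) := fun j₀ j₁ e => by
    split_ifs <;> simp [hx0]
  have hmul : ∀ (j₀ j₁ : ℕ) (e : Fin n × Fin n),
      y e * (if j₀ ≤ e.2.val ∧ e.2.val < j₁ then x₀ else 0) ≤ 1 := fun j₀ j₁ e => by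
    refine mul_le_one₀ (hy1 e) (hstrip j₀ j₁ e) ?_
    split_ifs <;> simp [hx1.le]
  set B₁ := site (s, n) + site (v, k + 1) with hB₁
  set B₂ := site (v', k) + site (t, 0) with hB₂
  have hC₁ := cosetSum_strips_le (κ := κ) hx0 hx1 hμ (j₀ := k + 1) (j₁ := n) (by omega) le_rfl hs hv hsp
  have hC₂ := cosetSum_strips_le (κ := κ) hx0 hx1 hμ (Nat.zero_le k) hk.le hv' ht hvp
  rw [add_comm (site _), ← hB₁] at hC₁
  rw [add_comm (site _), ← hB₂] at hC₂
  have s₁ := sum_containsChain_le (boundary κ n) (boundarySupported n) (y := y)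
    (D := fun e => k + 1 ≤ e.2.val) hy (hstrip (k + 1) n)
    (fun e he => by rw [if_pos ⟨he, e.2.2⟩]; exact hyx e) (hmul _ _) 0 B₁
    (g := fun F => if ContainsChain (boundary κ n) (fun e => e.2.val < k) B₂ F then 1 else 0)
    (fun F => by split_ifs <;> simp) (fun F K hK => by
      refine if_congr ?_ rfl rfl
      refine exists_congr fun K' => and_congr_left fun _ => forall_congr' fun e => ?_
      refine forall_congr' fun _ => and_congr_left fun he => ?_
      have : K e = 0 := by
        by_contra h
        have := hK e h
        omega
      simp [this]) hC₁
  have s₂ := sum_containsChain_le (boundary κ n) (boundarySupported n) (y := y)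
    (D := fun e => e.2.val < k) hy (hstrip 0 k)
    (fun e he => by rw [if_pos ⟨Nat.zero_le _, he⟩]; exact hyx e) (hmul _ _) B₁ B₂
    (g := fun F => 1) (fun F => zero_le_one) (fun F K hK => rfl) hC₂
  have s₃ := cosetSum_le_zero (boundary κ n) (boundarySupported n) hy hy1 (B₁ + B₂)
  have e₁ : (∑ F : Fin n × Fin n → ZMod 2, if boundary κ n F ∈ boundarySupported n ∧
        CrossesAt κ F k s v v' t then chainWeight y F else 0) =
      ∑ F, if boundary κ n F - 0 ∈ boundarySupported n ∧
          ContainsChain (boundary κ n) (fun e => k + 1 ≤ e.2.val) B₁ F then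
        chainWeight y F * (if ContainsChain (boundary κ n) (fun e => e.2.val < k) B₂ F
          then 1 else 0) else 0 := by
    refine sum_congr rfl fun F _ => ?_
    rw [sub_zero, mul_ite, mul_one, mul_zero, ← ite_and]
    exact if_congr (by rw [CrossesAt, and_assoc]) rfl rfl
  have e₂ : (∑ F, if boundary κ n F - (0 + B₁) ∈ boundarySupported n then
        chainWeight y F * (if ContainsChain (boundary κ n) (fun e => e.2.val < k) B₂ F
          then 1 else 0) else 0) =
      ∑ F, if boundary κ n F - B₁ ∈ boundarySupported n ∧
          ContainsChain (boundary κ n) (fun e => e.2.val < k) B₂ F then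
        chainWeight y F * 1 else 0 := by
    refine sum_congr rfl fun F _ => ?_
    rw [zero_add, mul_ite, mul_zero, ← ite_and]
  have e₃ : (∑ F, if boundary κ n F - (B₁ + B₂) ∈ boundarySupported n then
        chainWeight y F * 1 else 0) = cosetSum (boundary κ n) (boundarySupported n) y (B₁ + B₂) := by
    simp [cosetSum]
  rw [e₂] at s₁
  rw [e₃] at s₂
  rw [e₁]
  refine s₁.trans ?_
  calc _ ≤ ((n : ℝ) + 1) * μ ^ (n - (k + 1)) * (((n : ℝ) + 1) * μ ^ (k - 0) *
        cosetSum (boundary κ n) (boundarySupported n) y 0) :=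
        mul_le_mul_of_nonneg_left (s₂.trans (mul_le_mul_of_nonneg_left s₃ (by positivity)))
          (by positivity)
    _ = ((n : ℝ) + 1) ^ 2 * (μ ^ (n - (k + 1)) * μ ^ (k - 0)) *
        cosetSum (boundary κ n) (boundarySupported n) y 0 := by ring
    _ = _ := by
      rw [← pow_add, show n - (k + 1) + (k - 0) = n - 1 by omega]

/-- `F` contains chains crossing the square from top to bottom, except for one strip. -/
def Crosses (κ : ℕ) {n : ℕ} (F : Fin n × Fin n → ZMod 2) : Prop :=
  ∃ (k : Fin n) (s v v' t : Fin (n + 1)), (s.val + n + κ) % 2 = 0 ∧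
    (v'.val + k.val + κ) % 2 = 0 ∧ CrossesAt κ F k s v v' t

lemma sum_ite_exists_le {α ι : Type*} [Fintype α] [Fintype ι] (p : ι → α → Prop)
    (q : α → Prop) [DecidablePred q] [∀ i, DecidablePred (p i)] (f : α → ℝ) (hf : ∀ a, 0 ≤ f a)
    (hq : ∀ a, q a → ∃ i, p i a) :
    (∑ a, if q a then f a else 0) ≤ ∑ i, ∑ a, if p i a then f a else 0 := by
  rw [sum_comm]
  refine sum_le_sum fun a _ => ?_
  have hnn : ∀ i ∈ univ, 0 ≤ if p i a then f a else 0 := fun i _ => by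
    split_ifs <;> simp [hf]
  split_ifs with h
  · obtain ⟨i, hi⟩ := hq a h
    have := single_le_sum hnn (mem_univ i)
    rwa [if_pos hi] at this
  · exact sum_nonneg hnn

open Classical in
theorem sum_crosses_le {y : Fin n × Fin n → ℝ} {x₀ μ : ℝ} (hy : ∀ e, 0 ≤ y e)
    (hyx : ∀ e, y e ≤ x₀) (hx1 : x₀ < 1) (hμ0 : 0 ≤ μ) (hμ : 2 * x₀ ≤ μ * (1 - x₀ ^ 2)) :
    (∑ F : Fin n × Fin n → ZMod 2, if boundary κ n F ∈ boundarySupported n ∧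
        Crosses κ F then chainWeight y F else 0) ≤
      (n + 1) ^ 7 * μ ^ (n - 1) * cosetSum (boundary κ n) (boundarySupported n) y 0 := by
  set Z := cosetSum (boundary κ n) (boundarySupported n) y 0
  have hZ : 0 ≤ Z := cosetSum_nonneg _ _ hy 0
  refine (sum_ite_exists_le (ι := Fin n × (Fin (n + 1) × Fin (n + 1)) × Fin (n + 1) × Fin (n + 1))
    (fun i F => boundary κ n F ∈ boundarySupported n ∧ ((i.2.1.1.val + n + κ) % 2 = 0 ∧
      (i.2.2.1.val + i.1.val + κ) % 2 = 0) ∧ CrossesAt κ F i.1 i.2.1.1 i.2.1.2 i.2.2.1 i.2.2.2)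
    _ _ (chainWeight_nonneg hy) ?_).trans ?_
  · rintro F ⟨h, k, s, v, v', t, h1, h2, h3⟩
    exact ⟨(k, (s, v), v', t), h, ⟨h1, h2⟩, h3⟩
  · refine (sum_le_card_nsmul _ _ ((n + 1) ^ 2 * μ ^ (n - 1) * Z) ?_).trans ?_
    · rintro ⟨k, ⟨s, v⟩, v', t⟩ -
      by_cases hpar : (s.val + n + κ) % 2 = 0 ∧ (v'.val + k.val + κ) % 2 = 0
      · simpa [hpar] using sum_crossesAt_le (κ := κ) hy hyx hx1 hμ k.2 (Nat.lt_succ_iff.1 s.2)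
          (Nat.lt_succ_iff.1 v.2) (Nat.lt_succ_iff.1 v'.2) (Nat.lt_succ_iff.1 t.2) hpar.1 hpar.2
      · simp only [hpar, false_and, and_false, if_false, sum_const_zero]
        positivity
    · simp only [card_univ, Fintype.card_prod, Fintype.card_fin, nsmul_eq_mul, Nat.cast_mul,
        Nat.cast_add, Nat.cast_one]
      have : (0 : ℝ) ≤ (n + 1) ^ 6 * μ ^ (n - 1) * Z := by positivity
      nlinarith

/-- The boundary of a transposed edge set. -/
lemma boundary_swap (F : Fin n × Fin n → ZMod 2) (w : ℕ × ℕ) :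
    boundary κ n (fun e : Fin n × Fin n => F e.swap) w.swap = boundary κ n F w := by
  rw [boundary_apply, boundary_apply, ← Equiv.sum_comp (Equiv.prodComm _ _)]
  refine sum_congr rfl fun e _ => ?_
  simp only [Equiv.prodComm_apply, Prod.swap_swap, Prod.snd_swap, Prod.fst_swap]
  congr 1
  have hsw : ∀ u v : ℕ × ℕ, site u v.swap = site u.swap v := by
    intro u v
    simp only [site]
    exact if_congr ⟨fun h => by rw [← h, Prod.swap_swap], fun h => by rw [h, Prod.swap_swap]⟩ rfl rfl
  rw [hsw, hsw]
  rcases Nat.mod_two_eq_zero_or_one (e.1.val + e.2.val + κ) with h | h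
  · have h1 : (zigzag κ e.1 e.2).swap = zigzag κ e.2 e.1 := by
      simp [zigzag]; omega
    have h2 : (zigzag κ e.1 (e.2 + 1)).swap = zigzag κ e.2 (e.1 + 1) := by
      simp [zigzag]; omega
    rw [h1, h2]
  · have h1 : (zigzag κ e.1 e.2).swap = zigzag κ e.2 (e.1 + 1) := by
      simp [zigzag]; omega
    have h2 : (zigzag κ e.1 (e.2 + 1)).swap = zigzag κ e.2 e.1 := by
      simp [zigzag]; omega
    rw [h1, h2, add_comm]

lemma boundary_swap_mem (F : Fin n × Fin n → ZMod 2) :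
    boundary κ n (fun e : Fin n × Fin n => F e.swap) ∈ boundarySupported n ↔
      boundary κ n F ∈ boundarySupported n := by
  constructor
  · intro h p q h1 h2 h3 h4
    rw [← boundary_swap]
    exact h q p h3 h4 h1 h2
  · intro h p q h1 h2 h3 h4
    have := boundary_swap (κ := κ) F (q, p)
    rw [Prod.swap_prod_mk] at this
    rw [this]
    exact h q p h3 h4 h1 h2

lemma chainWeight_swap (y : Fin n × Fin n → ℝ) (F : Fin n × Fin n → ZMod 2) :
    chainWeight (fun e : Fin n × Fin n => y e.swap) (fun e : Fin n × Fin n => F e.swap) = chainWeight y F :=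
  Equiv.prod_comp (Equiv.prodComm (Fin n) (Fin n)) fun e => if F e = 0 then 1 else y e

open Classical in
theorem sum_crosses_swap_le {y : Fin n × Fin n → ℝ} {x₀ μ : ℝ} (hy : ∀ e, 0 ≤ y e)
    (hyx : ∀ e, y e ≤ x₀) (hx1 : x₀ < 1) (hμ0 : 0 ≤ μ) (hμ : 2 * x₀ ≤ μ * (1 - x₀ ^ 2)) :
    (∑ F : Fin n × Fin n → ZMod 2, if boundary κ n F ∈ boundarySupported n ∧
        Crosses κ (fun e : Fin n × Fin n => F e.swap) then chainWeight y F else 0) ≤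
      (n + 1) ^ 7 * μ ^ (n - 1) * cosetSum (boundary κ n) (boundarySupported n) y 0 := by
  have h := sum_crosses_le (κ := κ) (y := fun e : Fin n × Fin n => y e.swap) (fun e => hy _)
    (fun e => hyx _) hx1 hμ0 hμ
  have reindex : ∀ f : (Fin n × Fin n → ZMod 2) → ℝ, ∑ F, f F =
      ∑ F : Fin n × Fin n → ZMod 2, f (fun e : Fin n × Fin n => F e.swap) := fun f =>
    (Equiv.sum_comp (Equiv.arrowCongr (Equiv.prodComm (Fin n) (Fin n)) (Equiv.refl (ZMod 2))) f).symm
  have hZ : cosetSum (boundary κ n) (boundarySupported n) (fun e : Fin n × Fin n => y e.swap) 0 =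
      cosetSum (boundary κ n) (boundarySupported n) y 0 := by
    unfold cosetSum
    rw [reindex]
    refine sum_congr rfl fun F _ => ?_
    rw [chainWeight_swap]
    exact if_congr (by rw [sub_zero, sub_zero, boundary_swap_mem]) rfl rfl
  rw [hZ, reindex] at h
  refine le_trans (le_of_eq (sum_congr rfl fun F _ => ?_)) h
  rw [chainWeight_swap]
  exact if_congr (by rw [boundary_swap_mem]) rfl rfl

end Crossing

section Paths

variable {κ n : ℕ}

/-- The edge `e` of parity `κ` joins the sites `u` and `v`. -/
def Joins (κ : ℕ) {n : ℕ} (e : Fin n × Fin n) (u v : ℕ × ℕ) : Prop :=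
  (u = zigzag κ e.2 e.1 ∧ v = zigzag κ e.2 (e.1 + 1)) ∨
    (v = zigzag κ e.2 e.1 ∧ u = zigzag κ e.2 (e.1 + 1))

lemma Joins.symm {e : Fin n × Fin n} {u v : ℕ × ℕ} (h : Joins κ e u v) : Joins κ e v u :=
  Or.symm h

lemma Joins.boundary_single {e : Fin n × Fin n} {u v : ℕ × ℕ} (h : Joins κ e u v) :
    boundary κ n (Pi.single e 1) = site u + site v := by
  rw [_root_.boundary_single]
  rcases h with ⟨rfl, rfl⟩ | ⟨rfl, rfl⟩
  · rfl
  · rw [add_comm]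

lemma Joins.bounds {e : Fin n × Fin n} {u v : ℕ × ℕ} (h : Joins κ e u v) :
    v.1 ≤ n ∧ (v.1 + v.2 + κ) % 2 = 0 ∧ e.2.val ≤ v.2 ∧ v.2 ≤ e.2 + 1 := by
  have := e.1.2
  rcases h with ⟨_, rfl⟩ | ⟨rfl, _⟩ <;> simp only [zigzag] <;> omega

/-- A step along an edge that belongs to `F` unless it lies in strip `k`. -/
def StepExcept (κ : ℕ) {n : ℕ} (F : Fin n × Fin n → ZMod 2) (k : ℕ) (u v : ℕ × ℕ) : Prop :=
  ∃ e : Fin n × Fin n, Joins κ e u v ∧ (e.2.val ≠ k → F e ≠ 0)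

lemma reflTransGen_stepExcept_symm {F : Fin n × Fin n → ZMod 2} {k : ℕ} {u v : ℕ × ℕ}
    (h : Relation.ReflTransGen (StepExcept κ F k) u v) :
    Relation.ReflTransGen (StepExcept κ F k) v u :=
  h.swap.lift id fun _ _ ⟨e, he, hF⟩ => ⟨e, he.symm, hF⟩

lemma ContainsChain.add_single {D : Fin n × Fin n → Prop} {F : Fin n × Fin n → ZMod 2}
    {e : Fin n × Fin n} {u v w : ℕ × ℕ} (he : Joins κ e u v) (hF : F e ≠ 0) (hD : D e)
    (h : ContainsChain (boundary κ n) D (site v + site w) F) :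
    ContainsChain (boundary κ n) D (site u + site w) F := by
  obtain ⟨K, hK, hb⟩ := h
  refine ⟨Pi.single e 1 + K, fun f hf => ?_, ?_⟩
  · by_cases hfe : f = e
    · subst hfe; exact ⟨hF, hD⟩
    · exact hK f (by simpa [hfe] using hf)
  · rw [map_add, he.boundary_single, hb, add_assoc, ← add_assoc (site v), site_add_self, zero_add]

lemma containsChain_zero (D : Fin n × Fin n → Prop) (F : Fin n × Fin n → ZMod 2) (u : ℕ × ℕ) :
    ContainsChain (boundary κ n) D (site u + site u) F :=
  ⟨0, by simp, by rw [map_zero, site_add_self]⟩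

lemma exists_chain_down {F : Fin n × Fin n → ZMod 2} {k : ℕ} {u w : ℕ × ℕ}
    (h : Relation.ReflTransGen (StepExcept κ F k) u w) (hu : u.1 ≤ n) (huk : k + 1 ≤ u.2)
    (hw : w.2 ≤ k) :
    ∃ v ≤ n, ContainsChain (boundary κ n) (fun e => k + 1 ≤ e.2.val)
      (site u + site (v, k + 1)) F := by
  induction h using Relation.ReflTransGen.head_induction_on with
  | refl => omega
  | @head u u' hstep _ ih =>
    rcases huk.eq_or_lt with h | h
    · refine ⟨u.1, hu, ?_⟩
      have : (u.1, k + 1) = u := by rw [h]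
      rw [this]
      exact containsChain_zero _ _ _
    · obtain ⟨e, he, hF⟩ := hstep
      have h1 := he.bounds
      have h2 := he.symm.bounds
      obtain ⟨v, hv, hc⟩ := ih h1.1 (by omega)
      exact ⟨v, hv, hc.add_single he (hF (by omega)) (by omega)⟩

lemma exists_chain_up {F : Fin n × Fin n → ZMod 2} {k : ℕ} {u w : ℕ × ℕ}
    (h : Relation.ReflTransGen (StepExcept κ F k) u w) (hu : u.1 ≤ n) (huk : u.2 ≤ k)
    (hpar : (u.1 + u.2 + κ) % 2 = 0) (hw : k + 1 ≤ w.2) :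
    ∃ v ≤ n, (v + k + κ) % 2 = 0 ∧ ContainsChain (boundary κ n) (fun e => e.2.val < k)
      (site u + site (v, k)) F := by
  induction h using Relation.ReflTransGen.head_induction_on with
  | refl => omega
  | @head u u' hstep _ ih =>
    rcases huk.eq_or_lt with h | h
    · refine ⟨u.1, hu, by omega, ?_⟩
      have : (u.1, k) = u := by rw [← h]
      rw [this]
      exact containsChain_zero _ _ _
    · obtain ⟨e, he, hF⟩ := hstep
      have h1 := he.bounds
      have h2 := he.symm.bounds
      obtain ⟨v, hv, hv', hc⟩ := ih h1.1 (by omega) h1.2.1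
      exact ⟨v, hv, hv', hc.add_single he (hF (by omega)) (by omega)⟩

lemma crosses_of_path {F : Fin n × Fin n → ZMod 2} {k : Fin n} {u w : ℕ × ℕ}
    (h : Relation.ReflTransGen (StepExcept κ F k) u w) (hu : u.1 ≤ n) (hun : u.2 = n)
    (hw : w.1 ≤ n) (hw0 : w.2 = 0) (hpar : (u.1 + u.2 + κ) % 2 = 0) : Crosses κ F := by
  have hk := k.2
  have hwpar : (w.1 + w.2 + κ) % 2 = 0 := by
    rcases Relation.ReflTransGen.cases_tail h with rfl | ⟨v, _, e, he, _⟩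
    · exact hpar
    · exact he.bounds.2.1
  obtain ⟨v, hv, hc⟩ := exists_chain_down h hu (by omega) (by omega)
  obtain ⟨v', hv', hp', hc'⟩ :=
    exists_chain_up (reflTransGen_stepExcept_symm h) hw (by omega) hwpar (by omega)
  refine ⟨k, ⟨u.1, by omega⟩, ⟨v, by omega⟩, ⟨v', by omega⟩, ⟨w.1, by omega⟩, ?_, hp', ?_, ?_⟩
  · simpa [hun] using hpar
  · have : (u.1, n) = u := by rw [← hun]
    rw [← this] at hc
    exact hc
  · have : (w.1, 0) = w := by rw [← hw0]
    rw [← this, add_comm] at hc'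
    exact hc'

/-- The edges of `L_τ` of parity class `κ`. -/
def tauChain (κ : ℕ) {n : ℕ} (τ : EdgeConfig n) (e : Fin n × Fin n) : ZMod 2 :=
  if lTau τ (e, decide ((e.1.val + e.2.val + κ) % 2 = 0)) = true then 1 else 0

/-- The coordinates of an `L_n`-vertex. -/
def LVertex.coords (u : LVertex n) : ℕ × ℕ := (u.1.val, u.2.val)

lemma StepOnEdge.symm {e : LEdge n} {u v : LVertex n} (h : StepOnEdge e u v) :
    StepOnEdge e v u := Or.symm h

lemma StepOnEdge.joins {e : LEdge n} {u v : LVertex n} (h : StepOnEdge e u v)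
    (hu : (u.1.val + u.2.val + κ) % 2 = 0) :
    e.2 = decide ((e.1.1.val + e.1.2.val + κ) % 2 = 0) ∧
      Joins κ e.1 (LVertex.coords u) (LVertex.coords v) ∧
      Joins κ e.1.swap (LVertex.coords u).swap (LVertex.coords v).swap := by
  obtain ⟨⟨i, j⟩, b⟩ := e
  have key : ∀ {u v : LVertex n}, lEdgeEnds ((i, j), b) = (u, v) →
      ((u.1.val + u.2.val + κ) % 2 = 0 ∨ (v.1.val + v.2.val + κ) % 2 = 0) →
      b = decide ((i.val + j.val + κ) % 2 = 0) ∧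
      Joins κ (i, j) (LVertex.coords u) (LVertex.coords v) ∧
      Joins κ (j, i) (LVertex.coords u).swap (LVertex.coords v).swap := by
    intro u v h hp
    cases b
    · simp only [lEdgeEnds, Prod.mk.injEq] at h
      obtain ⟨rfl, rfl⟩ := h
      simp only [Fin.val_castSucc, Fin.val_succ] at hp
      refine ⟨by simp; omega, ?_, ?_⟩
      · right; simp [LVertex.coords, zigzag]; omega
      · left; simp [LVertex.coords, zigzag]; omega
    · simp only [lEdgeEnds, Prod.mk.injEq] at h
      obtain ⟨rfl, rfl⟩ := h
      simp only [Fin.val_castSucc, Fin.val_succ] at hp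
      refine ⟨by simp; omega, ?_, ?_⟩
      · left; simp [LVertex.coords, zigzag]; omega
      · left; simp [LVertex.coords, zigzag]; omega
  rcases h with h | h
  · exact key h (Or.inl hu)
  · have := key h (Or.inr hu)
    exact ⟨this.1, this.2.1.symm, this.2.2.symm⟩

lemma reflTransGen_of_pathSteps {α : Type*} {R : α → α → Prop} {p : List α}
    (h : ∀ t ∈ pathSteps p, R t.1 t.2) {u w : α} (hu : p.head? = some u)
    (hw : p.getLast? = some w) : Relation.ReflTransGen R u w := by
  induction p generalizing u with
  | nil => simp at hu
  | cons a p ih =>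
    obtain rfl : a = u := by simpa using hu
    cases p with
    | nil =>
      obtain rfl : a = w := by simpa using hw
      exact .refl
    | cons b p =>
      refine .head (h (a, b) (by simp [pathSteps])) (ih (fun t ht => h t ?_) rfl ?_)
      · simp only [pathSteps, List.tail_cons, List.zip_cons_cons, List.mem_cons] at ht ⊢
        exact Or.inr ht
      · simpa using hw

lemma rel_of_mem_pathSteps {α : Type*} {R : α → α → Prop} {p : List α} (h : List.IsChain R p) :
    ∀ t ∈ pathSteps p, R t.1 t.2 := by
  induction p with
  | nil => simp [pathSteps]
  | cons a p ih =>
    cases p with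
    | nil => simp [pathSteps]
    | cons b p =>
      have h' := List.isChain_cons_cons.1 h
      intro t ht
      simp only [pathSteps, List.tail_cons, List.zip_cons_cons, List.mem_cons] at ht
      rcases ht with rfl | ht
      · exact h'.1
      · exact ih h'.2 t ht

/-- All steps of an (almost) fault line are in `L_τ`, up to one edge. -/
lemma exists_exceptional_edge {τ : EdgeConfig n} {p : List (LVertex n)}
    (h : List.IsChain (LStep τ) p ∨ (List.IsChain LAdjacent p ∧
      ∃ s ∈ pathSteps p, ¬ LStep τ s.1 s.2 ∧ ∀ t ∈ pathSteps p, t ≠ s → LStep τ t.1 t.2))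
    (hn : 0 < n) :
    ∃ f : LEdge n, ∀ t ∈ pathSteps p, ∃ e : LEdge n, StepOnEdge e t.1 t.2 ∧
      (e ≠ f → lTau τ e = true) := by
  rcases h with h | ⟨h, s, hs, _, hst⟩
  · refine ⟨((⟨0, hn⟩, ⟨0, hn⟩), true), fun t ht => ?_⟩
    obtain ⟨e, he, hτ⟩ := rel_of_mem_pathSteps h t ht
    exact ⟨e, he, fun _ => hτ⟩
  · obtain ⟨f, hf⟩ := rel_of_mem_pathSteps h s hs
    refine ⟨f, fun t ht => ?_⟩
    by_cases hts : t = s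
    · subst hts
      exact ⟨f, hf, fun h => absurd rfl h⟩
    · obtain ⟨e, he, hτ⟩ := hst t ht hts
      exact ⟨e, he, fun _ => hτ⟩

lemma stepExcept_of_path {τ : EdgeConfig n} {f : LEdge n} {u w : LVertex n}
    (h : Relation.ReflTransGen (fun u v => ∃ e : LEdge n, StepOnEdge e u v ∧
      (e ≠ f → lTau τ e = true)) u w) (hu : (u.1.val + u.2.val + κ) % 2 = 0) :
    Relation.ReflTransGen (StepExcept κ (tauChain κ τ) f.1.2)
      (LVertex.coords u) (LVertex.coords w) ∧
    Relation.ReflTransGen (StepExcept κ (fun e : Fin n × Fin n => tauChain κ τ e.swap) f.1.1)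
      (LVertex.coords u).swap (LVertex.coords w).swap := by
  induction h using Relation.ReflTransGen.head_induction_on with
  | refl => exact ⟨.refl, .refl⟩
  | @head u v hstep _ ih =>
    obtain ⟨e, he, hτ⟩ := hstep
    obtain ⟨h1, h2, h3⟩ := he.joins hu
    obtain ⟨i1, i2⟩ := ih h2.bounds.2.1
    have hF : e ≠ f → tauChain κ τ e.1 ≠ 0 := by
      intro hef
      unfold tauChain
      rw [← h1, if_pos (hτ hef)]
      exact one_ne_zero
    refine ⟨.head ⟨e.1, h2, fun hk => hF ?_⟩ i1, .head ⟨e.1.swap, h3, fun hk => hF ?_⟩ i2⟩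
    · rintro rfl; exact hk rfl
    · rintro rfl; exact hk rfl

/-- A state with a fault line or an almost fault line has a crossing in one of the
two parity classes. -/
theorem exists_crosses_of_faultLine (hn : 0 < n) {τ : EdgeConfig n} (h : τ ∈ CFL n ∪ CAFL n) :
    IceRule τ ∧ ∃ κ : Fin 2, Crosses κ (tauChain κ τ) ∨
      Crosses κ (fun e : Fin n × Fin n => tauChain κ τ e.swap) := by
  have vert : ∀ p : List (LVertex n), (List.IsChain (LStep τ) p ∨ (List.IsChain LAdjacent p ∧
      ∃ s ∈ pathSteps p, ¬ LStep τ s.1 s.2 ∧ ∀ t ∈ pathSteps p, t ≠ s → LStep τ t.1 t.2)) →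
      (∃ u, p.head? = some u ∧ u.2 = Fin.last n) → (∃ u, p.getLast? = some u ∧ u.2 = 0) →
      ∃ κ : Fin 2, Crosses κ (tauChain κ τ) ∨
        Crosses κ (fun e : Fin n × Fin n => tauChain κ τ e.swap) := by
    rintro p hp ⟨u, hu, hun⟩ ⟨w, hw, hw0⟩
    obtain ⟨f, hf⟩ := exists_exceptional_edge hp hn
    refine ⟨⟨(u.1.val + u.2.val) % 2, by omega⟩, Or.inl ?_⟩
    refine crosses_of_path
      (stepExcept_of_path (reflTransGen_of_pathSteps hf hu hw) (by dsimp only; omega)).1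
      (Nat.lt_succ_iff.1 u.1.2) ?_ (Nat.lt_succ_iff.1 w.1.2) ?_ ?_
    · simp [LVertex.coords, hun]
    · simp [LVertex.coords, hw0]
    · simp only [LVertex.coords]; omega
  have horiz : ∀ p : List (LVertex n), (List.IsChain (LStep τ) p ∨ (List.IsChain LAdjacent p ∧
      ∃ s ∈ pathSteps p, ¬ LStep τ s.1 s.2 ∧ ∀ t ∈ pathSteps p, t ≠ s → LStep τ t.1 t.2)) →
      (∃ u, p.head? = some u ∧ u.1 = 0) → (∃ u, p.getLast? = some u ∧ u.1 = Fin.last n) →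
      ∃ κ : Fin 2, Crosses κ (tauChain κ τ) ∨
        Crosses κ (fun e : Fin n × Fin n => tauChain κ τ e.swap) := by
    rintro p hp ⟨w, hw, hw0⟩ ⟨u, hu, hun⟩
    obtain ⟨f, hf⟩ := exists_exceptional_edge hp hn
    refine ⟨⟨(w.1.val + w.2.val) % 2, by omega⟩, Or.inr ?_⟩
    have hpath := (stepExcept_of_path (κ := (w.1.val + w.2.val) % 2)
      (reflTransGen_of_pathSteps hf hw hu) (by omega))
    have hpar : (u.2.val + u.1.val + (w.1.val + w.2.val) % 2) % 2 = 0 := by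
      rcases Relation.ReflTransGen.cases_tail hpath.2 with h | ⟨v, _, e, he, _⟩
      · have := congrArg Prod.fst h
        have := congrArg Prod.snd h
        simp only [LVertex.coords, Prod.fst_swap, Prod.snd_swap] at *
        omega
      · exact he.bounds.2.1
    refine crosses_of_path (reflTransGen_stepExcept_symm hpath.2)
      (Nat.lt_succ_iff.1 u.2.2) ?_ (Nat.lt_succ_iff.1 w.2.2) ?_ hpar
    · simp [LVertex.coords, hun]
    · simp [LVertex.coords, hw0]
  rcases h with ⟨hice, ⟨p, _, _, h1, h2, h3⟩ | ⟨p, _, _, h1, h2, h3⟩⟩ |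
    ⟨hice, ⟨p, _, _, h1, h2, h3, h4⟩ | ⟨p, _, _, h1, h2, h3, h4⟩⟩
  · exact ⟨hice, horiz p (Or.inl h1) h2 h3⟩
  · exact ⟨hice, vert p (Or.inl h1) h2 h3⟩
  · exact ⟨hice, horiz p (Or.inr ⟨h1, h4⟩) h2 h3⟩
  · exact ⟨hice, vert p (Or.inr ⟨h1, h4⟩) h2 h3⟩

end Paths

section Potential

variable {κ n : ℕ}

lemma boundary_interior {F : Fin n × Fin n → ZMod 2} {i j : ℕ} (hi : i + 1 < n)
    (hj : j + 1 < n) : boundary κ n F (i + 1, j + 1) = if (i + j + κ) % 2 = 0 then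
      F (⟨i, by omega⟩, ⟨j, by omega⟩) + F (⟨i + 1, hi⟩, ⟨j + 1, hj⟩) +
        (F (⟨i + 1, hi⟩, ⟨j, by omega⟩) + F (⟨i, by omega⟩, ⟨j + 1, hj⟩)) else 0 := by
  rw [boundary_apply]
  split_ifs with h
  · have key : ∀ e : Fin n × Fin n, F e * (site (zigzag κ e.2 e.1) (i + 1, j + 1) +
        site (zigzag κ e.2 (e.1 + 1)) (i + 1, j + 1)) =
        (if e = (⟨i, by omega⟩, ⟨j, by omega⟩) then F e else 0) +
        (if e = (⟨i + 1, hi⟩, ⟨j + 1, hj⟩) then F e else 0) +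
        ((if e = (⟨i + 1, hi⟩, ⟨j, by omega⟩) then F e else 0) +
        (if e = (⟨i, by omega⟩, ⟨j + 1, hj⟩) then F e else 0)) := by
      rintro ⟨⟨p, hp⟩, ⟨q, hq⟩⟩
      simp only [site, zigzag, Prod.mk.injEq, Fin.mk.injEq]
      have cases : (p = i ∨ p = i + 1) ∧ (q = j ∨ q = j + 1) ∨
        ¬ ((p = i ∨ p = i + 1) ∧ (q = j ∨ q = j + 1)) := em _
      rcases cases with ⟨rfl | rfl, rfl | rfl⟩ | hne
      · rw [if_neg (by omega), if_pos (by omega), if_pos (by omega), if_neg (by omega),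
          if_neg (by omega), if_neg (by omega)]; ring
      · rw [if_neg (by omega), if_pos (by omega), if_neg (by omega), if_neg (by omega),
          if_neg (by omega), if_pos (by omega)]; ring
      · rw [if_pos (by omega), if_neg (by omega), if_neg (by omega), if_neg (by omega),
          if_pos (by omega), if_neg (by omega)]; ring
      · rw [if_pos (by omega), if_neg (by omega), if_neg (by omega), if_pos (by omega),
          if_neg (by omega), if_neg (by omega)]; ring
      · rw [if_neg (by omega), if_neg (by omega), if_neg (by omega), if_neg (by omega),
          if_neg (by omega), if_neg (by omega)]; ring
    simp only [key, sum_add_distrib, sum_ite_eq', mem_univ, if_true]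
  · refine sum_eq_zero fun e _ => ?_
    simp only [site, zigzag, Prod.mk.injEq]
    rw [if_neg (by omega), if_neg (by omega), add_zero, mul_zero]

/-- For each vertex, the sums of the colours of its left and bottom edges (in `F` or `G`,
according to parity), of its left and top edges (in the other one), and of all its edges. -/
def colorDiff (κ n : ℕ) : (Edge n → ZMod 2) →+
    (Fin n × Fin n → ZMod 2) × (Fin n × Fin n → ZMod 2) × (Fin n × Fin n → ZMod 2) where
  toFun q :=
    (fun e => q (leftE e.1 e.2) +
        if (e.1.val + e.2.val + κ) % 2 = 0 then q (botE e.1 e.2) else q (topE e.1 e.2),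
      fun e => q (leftE e.1 e.2) +
        if (e.1.val + e.2.val + κ) % 2 = 0 then q (topE e.1 e.2) else q (botE e.1 e.2),
      fun e => q (leftE e.1 e.2) + q (rightE e.1 e.2) + q (botE e.1 e.2) + q (topE e.1 e.2))
  map_zero' := by simp; rfl
  map_add' q q' := by
    ext e
    · simp only [Pi.add_apply, Prod.fst_add]; split_ifs <;> ring
    · simp only [Pi.add_apply, Prod.fst_add, Prod.snd_add]; split_ifs <;> ring
    · simp only [Pi.add_apply, Prod.snd_add]; ring

lemma mem_boundarySupported_iff {F : Fin n × Fin n → ZMod 2} :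
    boundary κ n F ∈ boundarySupported n ↔ ∀ i j (hi : i + 1 < n) (hj : j + 1 < n),
      (i + j + κ) % 2 = 0 → F (⟨i, by omega⟩, ⟨j, by omega⟩) + F (⟨i + 1, hi⟩, ⟨j + 1, hj⟩) +
        (F (⟨i + 1, hi⟩, ⟨j, by omega⟩) + F (⟨i, by omega⟩, ⟨j + 1, hj⟩)) = 0 := by
  constructor
  · intro h i j hi hj hp
    have := h (i + 1) (j + 1) (by omega) hi (by omega) hj
    rwa [boundary_interior hi hj, if_pos hp] at this
  · intro h p q hp hpn hq hqn
    obtain ⟨i, rfl⟩ : ∃ i, p = i + 1 := ⟨p - 1, by omega⟩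
    obtain ⟨j, rfl⟩ : ∃ j, q = j + 1 := ⟨q - 1, by omega⟩
    rw [boundary_interior hpn hqn]
    split_ifs with hp
    · exact h i j hpn hqn hp
    · rfl

/-- Both parity classes are closed iff the plaquette relation holds everywhere, where `d₁` and
`d₂` are the indicators of the two diagonals. -/
lemma closed_iff {F G d₁ d₂ : Fin n × Fin n → ZMod 2}
    (hF : ∀ e, F e = if (e.1.val + e.2.val + κ) % 2 = 0 then d₁ e else d₂ e)
    (hG : ∀ e, G e = if (e.1.val + e.2.val + κ) % 2 = 0 then d₂ e else d₁ e) :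
    boundary κ n F ∈ boundarySupported n ∧ boundary (κ + 1) n G ∈ boundarySupported n ↔
      ∀ i j (hi : i + 1 < n) (hj : j + 1 < n),
        d₁ (⟨i, by omega⟩, ⟨j, by omega⟩) + d₁ (⟨i + 1, hi⟩, ⟨j + 1, hj⟩) +
        (d₂ (⟨i + 1, hi⟩, ⟨j, by omega⟩) + d₂ (⟨i, by omega⟩, ⟨j + 1, hj⟩)) = 0 := by
  have eF : ∀ i j (hi : i + 1 < n) (hj : j + 1 < n), (i + j + κ) % 2 = 0 →
      F (⟨i, by omega⟩, ⟨j, by omega⟩) + F (⟨i + 1, hi⟩, ⟨j + 1, hj⟩) +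
        (F (⟨i + 1, hi⟩, ⟨j, by omega⟩) + F (⟨i, by omega⟩, ⟨j + 1, hj⟩)) =
      d₁ (⟨i, by omega⟩, ⟨j, by omega⟩) + d₁ (⟨i + 1, hi⟩, ⟨j + 1, hj⟩) +
        (d₂ (⟨i + 1, hi⟩, ⟨j, by omega⟩) + d₂ (⟨i, by omega⟩, ⟨j + 1, hj⟩)) := by
    intro i j hi hj hp
    simp only [hF]
    rw [if_pos (by omega), if_pos (by omega), if_neg (by omega), if_neg (by omega)]
  have eG : ∀ i j (hi : i + 1 < n) (hj : j + 1 < n), (i + j + (κ + 1)) % 2 = 0 →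
      G (⟨i, by omega⟩, ⟨j, by omega⟩) + G (⟨i + 1, hi⟩, ⟨j + 1, hj⟩) +
        (G (⟨i + 1, hi⟩, ⟨j, by omega⟩) + G (⟨i, by omega⟩, ⟨j + 1, hj⟩)) =
      d₁ (⟨i, by omega⟩, ⟨j, by omega⟩) + d₁ (⟨i + 1, hi⟩, ⟨j + 1, hj⟩) +
        (d₂ (⟨i + 1, hi⟩, ⟨j, by omega⟩) + d₂ (⟨i, by omega⟩, ⟨j + 1, hj⟩)) := by
    intro i j hi hj hp
    simp only [hG]
    rw [if_neg (by omega), if_neg (by omega), if_pos (by omega), if_pos (by omega)]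
  rw [mem_boundarySupported_iff, mem_boundarySupported_iff]
  constructor
  · rintro ⟨h, h'⟩ i j hi hj
    rcases Nat.mod_two_eq_zero_or_one (i + j + κ) with hp | hp
    · rw [← eF i j hi hj hp]; exact h i j hi hj hp
    · rw [← eG i j hi hj (by omega)]; exact h' i j hi hj (by omega)
  · exact fun h => ⟨fun i j hi hj hp => by rw [eF i j hi hj hp]; exact h i j hi hj,
      fun i j hi hj hp => by rw [eG i j hi hj hp]; exact h i j hi hj⟩

/-- The plaquette relation is exactly the condition for `d₁` and `d₂` to come from colours. -/
lemma exists_colors_iff {d₁ d₂ : Fin n × Fin n → ZMod 2} :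
    (∃ q : Edge n → ZMod 2, ∀ i j, q (leftE i j) + q (botE i j) = d₁ (i, j) ∧
      q (leftE i j) + q (topE i j) = d₂ (i, j) ∧
      q (leftE i j) + q (rightE i j) + q (botE i j) + q (topE i j) = 0) ↔
      ∀ i j (hi : i + 1 < n) (hj : j + 1 < n),
        d₁ (⟨i, by omega⟩, ⟨j, by omega⟩) + d₁ (⟨i + 1, hi⟩, ⟨j + 1, hj⟩) +
        (d₂ (⟨i + 1, hi⟩, ⟨j, by omega⟩) + d₂ (⟨i, by omega⟩, ⟨j + 1, hj⟩)) = 0 := by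
  constructor
  · rintro ⟨q, hq⟩ i j hi hj
    have h00 := (hq ⟨i, by omega⟩ ⟨j, by omega⟩).2.2
    have h01 := (hq ⟨i, by omega⟩ ⟨j + 1, hj⟩).2.2
    rw [← (hq _ _).1, ← (hq _ _).1, ← (hq _ _).2.1, ← (hq _ _).2.1]
    have e1 : leftE (⟨i + 1, hi⟩ : Fin n) (⟨j, by omega⟩ : Fin n) =
      rightE ⟨i, by omega⟩ ⟨j, by omega⟩ := rfl
    have e2 : leftE (⟨i + 1, hi⟩ : Fin n) (⟨j + 1, hj⟩ : Fin n) =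
      rightE ⟨i, by omega⟩ ⟨j + 1, hj⟩ := rfl
    have e3 : botE (⟨i + 1, hi⟩ : Fin n) (⟨j + 1, hj⟩ : Fin n) =
      topE ⟨i + 1, hi⟩ ⟨j, by omega⟩ := rfl
    have e4 : botE (⟨i, by omega⟩ : Fin n) (⟨j + 1, hj⟩ : Fin n) =
      topE ⟨i, by omega⟩ ⟨j, by omega⟩ := rfl
    rw [e4] at h01
    rw [e1, e2, e3]
    have hz : ∀ l b r t l' r' t' x : ZMod 2, l + r + b + t = 0 → l' + r' + t + t' = 0 →
      l + b + (r' + x) + (r + x + (l' + t')) = 0 := by decide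
    exact hz _ _ _ _ _ _ _ _ h00 h01
  · intro h
    let D₁ : ℕ → ℕ → ZMod 2 := fun i j => if h : i < n ∧ j < n then d₁ (⟨i, h.1⟩, ⟨j, h.2⟩) else 0
    let D₂ : ℕ → ℕ → ZMod 2 := fun i j => if h : i < n ∧ j < n then d₂ (⟨i, h.1⟩, ⟨j, h.2⟩) else 0
    have hD₁ : ∀ i j : Fin n, D₁ i j = d₁ (i, j) := fun i j => dif_pos ⟨i.2, j.2⟩
    have hD₂ : ∀ i j : Fin n, D₂ i j = d₂ (i, j) := fun i j => dif_pos ⟨i.2, j.2⟩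
    let H : ℕ → ℕ → ZMod 2 := fun k j =>
      ∑ j' ∈ range j, (D₂ 0 j' + D₁ 0 (j' + 1)) + ∑ i ∈ range k, (D₁ i j + D₂ i j)
    have hH : ∀ k j, H (k + 1) j = H k j + (D₁ k j + D₂ k j) := fun k j => by
      simp only [H, sum_range_succ _ k, add_assoc]
    have hV : ∀ i j, i < n → j + 1 < n → H i j + H i (j + 1) = D₂ i j + D₁ i (j + 1) := by
      intro i j hi hj
      induction i with
      | zero =>
        simp only [H, sum_range_succ _ j, range_zero, sum_empty, add_zero, ← add_assoc]
        have hz : ∀ x y z : ZMod 2, x + x + y + z = y + z := by decide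
        exact hz _ _ _
      | succ i ih =>
        have hz : ∀ x y a b c d e f : ZMod 2, x + y = b + c → a + e + (f + d) = 0 →
          x + (a + b) + (y + (c + d)) = f + e := by decide
        rw [hH, hH]
        refine hz _ _ _ _ _ _ _ _ (ih (by omega)) ?_
        have := h i j hi hj
        rw [← hD₁, ← hD₁, ← hD₂, ← hD₂] at this
        exact this
    let q : Edge n → ZMod 2
      | .horiz k j => H k j
      | .vert i k => if k.val = 0 then H i 0 + D₁ i 0 else H i (k.val - 1) + D₂ i (k.val - 1)
    have hql : ∀ i j : Fin n, q (leftE i j) = H i j := fun _ _ => rfl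
    have hqr : ∀ i j : Fin n, q (rightE i j) = H (i + 1) j := fun _ _ => rfl
    have hqt : ∀ i j : Fin n, q (topE i j) = H i j + D₂ i j := fun i j => by
      simp [q, topE]
    have hqb : ∀ i j : Fin n, q (botE i j) = H i j + D₁ i j := fun i j => by
      obtain ⟨j, hj⟩ := j
      cases j with
      | zero => simp [q, botE]
      | succ j =>
        have hz : ∀ x y a b : ZMod 2, x + y = a + b → x + a = y + b := by decide
        simpa [q, botE] using hz _ _ _ _ (hV i j i.2 hj)
    refine ⟨q, fun i j => ?_⟩
    rw [hql, hqr, hqt, hqb, hH, ← hD₁, ← hD₂]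
    have hz : ∀ x a b : ZMod 2, x + (x + a) = a ∧ x + (x + b) = b ∧
      x + (x + (a + b)) + (x + a) + (x + b) = 0 := by decide
    exact hz _ _ _

lemma mem_range_colorDiff {F G : Fin n × Fin n → ZMod 2} :
    (∃ q, colorDiff κ n q = (F, G, 0)) ↔
      boundary κ n F ∈ boundarySupported n ∧ boundary (κ + 1) n G ∈ boundarySupported n := by
  obtain ⟨d₁, hd₁⟩ : ∃ d₁ : Fin n × Fin n → ZMod 2,
    ∀ e, d₁ e = if (e.1.val + e.2.val + κ) % 2 = 0 then F e else G e := ⟨_, fun _ => rfl⟩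
  obtain ⟨d₂, hd₂⟩ : ∃ d₂ : Fin n × Fin n → ZMod 2,
    ∀ e, d₂ e = if (e.1.val + e.2.val + κ) % 2 = 0 then G e else F e := ⟨_, fun _ => rfl⟩
  rw [closed_iff (d₁ := d₁) (d₂ := d₂) (fun e => by rw [hd₁, hd₂]; split_ifs <;> rfl)
    (fun e => by rw [hd₁, hd₂]; split_ifs <;> rfl), ← exists_colors_iff]
  refine exists_congr fun q => ?_
  simp only [colorDiff, AddMonoidHom.coe_mk, ZeroHom.coe_mk, Prod.mk.injEq, funext_iff,
    Prod.forall, ← forall_and, Pi.zero_apply, hd₁, hd₂]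
  refine forall_congr' fun i => forall_congr' fun j => ?_
  split_ifs <;> tauto

end Potential

section States

variable {κ n : ℕ}

/-- Colours as elements of `ZMod 2`: green is `0` and red is `1`. -/
def colorEquiv (n : ℕ) : EdgeConfig n ≃ (Edge n → ZMod 2) where
  toFun τ e := if greenB τ e = true then 0 else 1
  invFun q e := if q e = 0 then greenOrient e else !greenOrient e
  left_inv τ := by
    funext e
    cases h : τ e <;> cases h' : greenOrient e <;> simp [greenB, h, h']
  right_inv q := by
    funext e
    have h : q e = 0 ∨ q e = 1 := by generalize q e = z; revert z; decide
    rcases h with h | h <;> simp [greenB, h]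

/-- The indicators of the two diagonals at a vertex, from its `d₁`- and `d₂`-values. -/
lemma vertex_table (g l r b t : Bool) :
    let z : Bool → ZMod 2 := fun x => if x = true then 0 else 1
    let gl := z (l == g)
    let gr := z (r == !g)
    let gb := z (b == !g)
    let gt := z (t == g)
    ((cond l 1 0 + cond r 0 1 + cond b 1 0 + cond t 0 1 = 2) ↔
      gl + gr + gb + gt = 0 ∧ (gl + gb = 0 ∨ gl + gt = 0)) ∧
    ((cond l 1 0 + cond r 0 1 + cond b 1 0 + cond t 0 1 = 2) →
      ((((l == g) == (t == g)) && ((r == !g) == (b == !g)) &&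
        !((l == g) == (r == !g))) = true ↔ gl + gb = 1) ∧
      ((((l == g) == (b == !g)) && ((r == !g) == (t == g)) &&
        !((l == g) == (r == !g))) = true ↔ gl + gt = 1) ∧
      (l ≠ r ↔ gl + gb = 0 ∧ gl + gt = 0) ∧ (l = r → (l = b ↔ gl + gb = 1))) := by
  revert g l r b t; decide

lemma greenOrient_right (i j : Fin n) : greenOrient (rightE i j) = !greenOrient (leftE i j) := by
  simp only [greenOrient, rightE, leftE, Fin.val_succ, Fin.val_castSucc]
  rw [Bool.eq_iff_iff]; simp; omega

lemma greenOrient_bot (i j : Fin n) : greenOrient (botE i j) = !greenOrient (leftE i j) := by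
  simp only [greenOrient, botE, leftE, Fin.val_castSucc]
  rw [Bool.eq_iff_iff]; simp

lemma greenOrient_top (i j : Fin n) : greenOrient (topE i j) = greenOrient (leftE i j) := by
  simp only [greenOrient, topE, leftE, Fin.val_succ, Fin.val_castSucc]
  rw [Bool.eq_iff_iff]; simp; omega

lemma iceRule_iff (κ : ℕ) (τ : EdgeConfig n) :
    IceRule τ ↔ (colorDiff κ n (colorEquiv n τ)).2.2 = 0 ∧
      ∀ e, (colorDiff κ n (colorEquiv n τ)).1 e = 0 ∨
        (colorDiff κ n (colorEquiv n τ)).2.1 e = 0 := by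
  rw [funext_iff, ← forall_and, Prod.forall]
  refine forall_congr' fun i => forall_congr' fun j => ?_
  have h := (vertex_table (greenOrient (leftE i j)) (τ (leftE i j)) (τ (rightE i j))
    (τ (botE i j)) (τ (topE i j))).1
  rw [inDegree, h]
  simp only [colorDiff, AddMonoidHom.coe_mk, ZeroHom.coe_mk, colorEquiv, Equiv.coe_fn_mk, greenB,
    greenOrient_right, greenOrient_bot, greenOrient_top, Pi.zero_apply]
  refine and_congr_right fun _ => ?_
  by_cases hp : (i.val + j.val + κ) % 2 = 0
  · simp only [hp, if_true]
    exact Iff.rfl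
  · simp only [hp, if_false]
    exact or_comm

lemma tauChain_eq (κ : ℕ) {τ : EdgeConfig n} (h : IceRule τ) :
    tauChain κ τ = (colorDiff κ n (colorEquiv n τ)).1 := by
  funext ⟨i, j⟩
  have h1 := (vertex_table (greenOrient (leftE i j)) (τ (leftE i j)) (τ (rightE i j))
    (τ (botE i j)) (τ (topE i j))).2 (h i j)
  have hz : ∀ (P : Prop) [Decidable P] (z : ZMod 2), (P ↔ z = 1) → (if P then 1 else 0) = z := by
    intro P _ z hP
    have : z = 0 ∨ z = 1 := by clear hP; revert z; decide
    rcases this with rfl | rfl <;> simp [hP]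
  unfold tauChain
  simp only [colorDiff, AddMonoidHom.coe_mk, ZeroHom.coe_mk, colorEquiv, Equiv.coe_fn_mk, greenB]
  by_cases hp : (i.val + j.val + κ) % 2 = 0
  · simp only [hp, decide_true, if_true, lTau, greenB, greenOrient_right, greenOrient_bot,
      greenOrient_top]
    exact hz _ _ h1.1
  · simp only [hp, decide_false, if_false, lTau, greenB, greenOrient_right, greenOrient_bot,
      greenOrient_top]
    exact hz _ _ h1.2.1

/-- The relative weight of the edge of parity class `κ` in cell `e`. -/
noncomputable def edgeWeight (κ : ℕ) {n : ℕ} (a b c : ℝ) (e : Fin n × Fin n) : ℝ :=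
  if (e.1.val + e.2.val + κ) % 2 = 0 then a / c else b / c

lemma weight_eq (κ : ℕ) {a b c : ℝ} (hc : c ≠ 0) {τ : EdgeConfig n} (h : IceRule τ) :
    weight a b c τ = c ^ Fintype.card (Fin n × Fin n) *
      (chainWeight (edgeWeight (κ + 1) a b c) (colorDiff κ n (colorEquiv n τ)).2.1 *
        chainWeight (edgeWeight κ a b c) (colorDiff κ n (colorEquiv n τ)).1) := by
  unfold weight chainWeight
  rw [← prod_mul_distrib, ← card_univ, ← prod_const, ← prod_mul_distrib]
  refine prod_congr rfl fun ⟨i, j⟩ _ => ?_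
  obtain ⟨-, -, h1, h2⟩ := (vertex_table (greenOrient (leftE i j)) (τ (leftE i j))
    (τ (rightE i j)) (τ (botE i j)) (τ (topE i j))).2 (h i j)
  have hor := ((iceRule_iff κ τ).1 h).2 (i, j)
  simp only [colorDiff, AddMonoidHom.coe_mk, ZeroHom.coe_mk, colorEquiv, Equiv.coe_fn_mk, greenB,
    greenOrient_right, greenOrient_bot, greenOrient_top, edgeWeight, vertexWeight] at hor ⊢
  have key : ∀ d₁ d₂ : ZMod 2, d₁ = 0 ∨ d₂ = 0 →
      (τ (leftE i j) ≠ τ (rightE i j) ↔ d₁ = 0 ∧ d₂ = 0) →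
      (τ (leftE i j) = τ (rightE i j) → (τ (leftE i j) = τ (botE i j) ↔ d₁ = 1)) →
      (if τ (leftE i j) ≠ τ (rightE i j) then c
        else if τ (leftE i j) = τ (botE i j) then a else b) =
      c * ((if d₁ = 0 then 1 else a / c) * (if d₂ = 0 then 1 else b / c)) := by
    intro d₁ d₂ hor' h1 h2
    have hz' : (1 : ZMod 2) ≠ 0 := by decide
    have hd₁ : d₁ = 0 ∨ d₁ = 1 := by clear * -; revert d₁; decide
    by_cases hl : τ (leftE i j) = τ (rightE i j)
    · rw [if_neg (not_not.2 hl), if_congr (h2 hl) rfl rfl]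
      rcases hd₁ with rfl | rfl
      · have hd₂ : d₂ ≠ 0 := fun h => (h1.2 ⟨rfl, h⟩) hl
        simp [hd₂]
        field_simp
      · simp [hor'.resolve_left hz']
        field_simp
    · rw [if_pos hl, if_pos (h1.1 hl).1, if_pos (h1.1 hl).2]
      ring
  by_cases hp : (i.val + j.val + κ) % 2 = 0
  · have hp' : ¬ (i.val + j.val + (κ + 1)) % 2 = 0 := by omega
    simp only [hp, hp', if_true, if_false] at hor ⊢
    rw [key _ _ hor h1 h2, mul_comm (ite _ _ _)]
  · have hp' : (i.val + j.val + (κ + 1)) % 2 = 0 := by omega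
    simp only [hp, hp', if_true, if_false] at hor ⊢
    rw [key _ _ hor.symm h1 h2]

end States

section Factorization

variable {κ n : ℕ}

/-- A sum over a finite group of a function factoring through a homomorphism. -/
lemma AddMonoidHom.sum_comp_eq {A B : Type*} [AddCommGroup A] [Fintype A] [AddCommGroup B]
    [Fintype B] (D : A →+ B) : ∃ N : ℝ, 0 < N ∧ ∀ f : B → ℝ, (∀ p, (¬ ∃ q, D q = p) → f p = 0) →
      ∑ q, f (D q) = N * ∑ p, f p := by
  classical
  refine ⟨#{q | D q = 0}, by exact_mod_cast card_pos.2 ⟨0, by simp⟩, fun f hf => ?_⟩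
  rw [← sum_fiberwise univ D, mul_sum]
  refine sum_congr rfl fun p _ => ?_
  rw [sum_congr rfl (fun q hq => by rw [(mem_filter.1 hq).2] : ∀ q ∈ univ.filter (D · = p),
    f (D q) = f p), sum_const, nsmul_eq_mul]
  by_cases hp : ∃ q, D q = p
  · congr 2
    obtain ⟨q₀, rfl⟩ := hp
    refine card_bij' (fun q _ => q - q₀) (fun q _ => q + q₀) ?_ ?_ ?_ ?_ <;>
      simp +contextual
  · rw [hf p hp, mul_zero, mul_zero]

open Classical in
/-- The generating function of the states, in terms of the two parity classes. -/
lemma exists_sum_states_eq (κ : ℕ) {a b c : ℝ} (hc : 0 < c) :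
    ∃ N : ℝ, 0 < N ∧ ∀ Q : (Fin n × Fin n → ZMod 2) → Prop,
      ∑ τ : EdgeConfig n, (if IceRule τ ∧ Q (tauChain κ τ) then weight a b c τ else 0) =
      N * ∑ G : Fin n × Fin n → ZMod 2,
        (if boundary (κ + 1) n G ∈ boundarySupported n then
          chainWeight (edgeWeight (κ + 1) a b c) G else 0) *
        ∑ F : Fin n × Fin n → ZMod 2, if boundary κ n F ∈ boundarySupported n ∧ Q F then
          chainWeight (fun e => if G e = 0 then edgeWeight κ a b c e else 0) F else 0 := by
  obtain ⟨N, hN, h⟩ := (colorDiff κ n).sum_comp_eq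
  refine ⟨N * c ^ Fintype.card (Fin n × Fin n), by positivity, fun Q => ?_⟩
  have hmul : ∀ F G : Fin n × Fin n → ZMod 2,
      chainWeight (fun e => if G e = 0 then edgeWeight κ a b c e else 0) F =
        if ∀ e, F e = 0 ∨ G e = 0 then chainWeight (edgeWeight κ a b c) F else 0 := by
    intro F G
    unfold chainWeight
    split_ifs with hd
    · refine prod_congr rfl fun e _ => ?_
      rcases hd e with h | h <;> simp [h]
    · obtain ⟨e, he⟩ := not_forall.1 hd
      rw [not_or] at he
      exact prod_eq_zero (mem_univ e) (by simp [he.1, he.2])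
  have hsum := h (fun p => if p.2.2 = 0 ∧ (boundary κ n p.1 ∈ boundarySupported n ∧
      boundary (κ + 1) n p.2.1 ∈ boundarySupported n) ∧ (∀ e, p.1 e = 0 ∨ p.2.1 e = 0) ∧ Q p.1 then
      c ^ Fintype.card (Fin n × Fin n) * (chainWeight (edgeWeight (κ + 1) a b c) p.2.1 *
        chainWeight (edgeWeight κ a b c) p.1) else 0) (by
    rintro ⟨F, G, S⟩ hne
    refine if_neg fun hp => hne ?_
    obtain ⟨rfl, hp, -⟩ := hp
    exact mem_range_colorDiff.2 hp)
  have hl : ∑ τ : EdgeConfig n, (if IceRule τ ∧ Q (tauChain κ τ) then weight a b c τ else 0) = _ :=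
    Eq.trans (Fintype.sum_equiv (colorEquiv n) _ _ fun τ => ?_) hsum
  · rw [hl, mul_assoc]
    congr 1
    rw [Fintype.sum_prod_type_right, Fintype.sum_prod_type, mul_sum]
    refine sum_congr rfl fun G _ => ?_
    rw [sum_eq_single 0 (fun S _ hS => by simp [hS]) (by simp), mul_sum, mul_sum]
    refine sum_congr rfl fun F _ => ?_
    rw [hmul]
    by_cases h1 : boundary κ n F ∈ boundarySupported n <;>
    by_cases h2 : boundary (κ + 1) n G ∈ boundarySupported n <;>
    by_cases h3 : (∀ e, F e = 0 ∨ G e = 0) <;>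
    by_cases h4 : Q F <;> simp [h1, h2, h3, h4]
  · by_cases hice : IceRule τ
    · have hi := (iceRule_iff κ τ).1 hice
      have hr := mem_range_colorDiff (κ := κ) (n := n)
        (F := (colorDiff κ n (colorEquiv n τ)).1) (G := (colorDiff κ n (colorEquiv n τ)).2.1)
      have hm := hr.1 ⟨colorEquiv n τ, by rw [← hi.1]⟩
      refine if_congr ?_ (weight_eq κ hc.ne' hice) rfl
      rw [tauChain_eq κ hice]
      exact ⟨fun h => ⟨hi.1, hm, hi.2, h.2⟩, fun h => ⟨hice, h.2.2.2⟩⟩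
    · rw [if_neg (fun h => hice h.1), if_neg]
      exact fun h => hice ((iceRule_iff κ τ).2 ⟨h.1, h.2.2.1⟩)

lemma edgeWeight_nonneg {a b c : ℝ} (ha : 0 < a) (hb : 0 < b) (hc : 0 < c) (e : Fin n × Fin n) :
    0 ≤ edgeWeight κ a b c e := by
  unfold edgeWeight; split_ifs <;> positivity

lemma edgeWeight_le {a b c : ℝ} (hc : 0 < c) (e : Fin n × Fin n) :
    edgeWeight κ a b c e ≤ max a b / c := by
  unfold edgeWeight; split_ifs <;> gcongr <;> simp

open Classical in
/-- A bound on the weight of closed chains with property `Q` gives a bound for states. -/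
lemma sum_states_le {a b c C : ℝ} (ha : 0 < a) (hb : 0 < b) (hc : 0 < c)
    {Q : (Fin n × Fin n → ZMod 2) → Prop}
    (h : ∀ y : Fin n × Fin n → ℝ, (∀ e, 0 ≤ y e) → (∀ e, y e ≤ max a b / c) →
      (∑ F : Fin n × Fin n → ZMod 2,
        if boundary κ n F ∈ boundarySupported n ∧ Q F then chainWeight y F else 0) ≤
        C * cosetSum (boundary κ n) (boundarySupported n) y 0) :
    (∑ τ : EdgeConfig n, if IceRule τ ∧ Q (tauChain κ τ) then weight a b c τ else 0) ≤
      C * Zsum n a b c := by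
  obtain ⟨N, hN, hs⟩ := exists_sum_states_eq (n := n) κ (a := a) (b := b) hc
  have hZ : Zsum n a b c = _ := Eq.trans (by simp [Zsum, sum_filter]) (hs fun _ => True)
  rw [hs, hZ, mul_left_comm, mul_sum _ _ C]
  refine mul_le_mul_of_nonneg_left (sum_le_sum fun G _ => ?_) hN.le
  rw [mul_left_comm]
  refine mul_le_mul_of_nonneg_left ?_ ?_
  · refine (h _ (fun e => ?_) (fun e => ?_)).trans (le_of_eq ?_)
    · split_ifs
      exacts [edgeWeight_nonneg ha hb hc e, le_rfl]
    · split_ifs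
      exacts [edgeWeight_le hc e, by positivity]
    · simp [cosetSum]
  · split_ifs
    exacts [chainWeight_nonneg (edgeWeight_nonneg ha hb hc) G, le_rfl]

end Factorization

lemma exists_bound_pow_mul_geometric {q : ℝ} (hq : 0 < q) (hq1 : q < 1) (k : ℕ) :
    ∃ K : ℝ, 0 < K ∧ ∀ n : ℕ, 1 ≤ n → ((n : ℝ) + 1) ^ k * q ^ (n - 1) ≤ K := by
  have ht := tendsto_pow_const_mul_const_pow_of_abs_lt_one k (abs_lt.2 ⟨by linarith, hq1⟩ : |q| < 1)
  obtain ⟨B, hB⟩ := ht.bddAbove_range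
  refine ⟨max B 1 / q ^ 2, by positivity, fun n hn => ?_⟩
  have h := (hB ⟨n + 1, rfl⟩).trans (le_max_left B 1)
  rw [le_div_iff₀ (by positivity), mul_assoc, ← pow_add, show n - 1 + 2 = n + 1 by omega]
  simpa using h

lemma piSet_faultLines_le {n : ℕ} (hn : 0 < n) {a b c μ : ℝ} (ha : 0 < a) (hb : 0 < b)
    (hc : 0 < c) (hx1 : max a b / c < 1) (hμ0 : 0 ≤ μ)
    (hμ : 2 * (max a b / c) ≤ μ * (1 - (max a b / c) ^ 2)) :
    piSet n a b c (CFL n ∪ CAFL n) ≤ 4 * ((n + 1) ^ 7 * μ ^ (n - 1)) := by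
  classical
  have hw : ∀ τ : EdgeConfig n, 0 ≤ weight a b c τ := fun τ =>
    prod_nonneg fun v _ => by unfold vertexWeight; split_ifs <;> positivity
  have hv : ∀ κ : ℕ, (∑ τ : EdgeConfig n, if IceRule τ ∧ Crosses κ (tauChain κ τ) then
      weight a b c τ else 0) ≤ (n + 1) ^ 7 * μ ^ (n - 1) * Zsum n a b c := fun κ =>
    sum_states_le (κ := κ) ha hb hc fun y hy hyx => sum_crosses_le hy hyx hx1 hμ0 hμ
  have hh : ∀ κ : ℕ, (∑ τ : EdgeConfig n, if IceRule τ ∧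
      Crosses κ (fun e : Fin n × Fin n => tauChain κ τ e.swap) then
      weight a b c τ else 0) ≤ (n + 1) ^ 7 * μ ^ (n - 1) * Zsum n a b c := fun κ =>
    sum_states_le (κ := κ) (Q := fun F => Crosses κ (fun e : Fin n × Fin n => F e.swap))
      ha hb hc fun y hy hyx => sum_crosses_swap_le hy hyx hx1 hμ0 hμ
  refine div_le_of_le_mul₀ (sum_nonneg fun τ _ => hw τ) (by positivity) ?_
  calc _ ≤ ∑ τ : EdgeConfig n, ∑ κ : Fin 2,
        ((if IceRule τ ∧ Crosses κ (tauChain κ τ) then weight a b c τ else 0) +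
        if IceRule τ ∧ Crosses κ (fun e : Fin n × Fin n => tauChain κ τ e.swap) then
          weight a b c τ else 0) := by
        have hnn : ∀ (P : Prop) [Decidable P] (τ : EdgeConfig n),
            0 ≤ if P then weight a b c τ else 0 := fun P _ τ => by split_ifs <;> simp [hw]
        rw [sum_filter]
        refine sum_le_sum fun τ _ => ?_
        split_ifs with hτ
        · obtain ⟨hice, κ, h⟩ := exists_crosses_of_faultLine hn hτ
          refine le_trans ?_ (single_le_sum (fun κ _ => add_nonneg (hnn _ τ) (hnn _ τ))
            (mem_univ κ))
          rcases h with h | h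
          · rw [if_pos ⟨hice, h⟩]
            exact le_add_of_nonneg_right (hnn _ τ)
          · rw [if_pos (c := _ ∧ Crosses _ (fun e : Fin n × Fin n => _)) ⟨hice, h⟩]
            exact le_add_of_nonneg_left (hnn _ τ)
        · exact sum_nonneg fun κ _ => add_nonneg (hnn _ τ) (hnn _ τ)
    _ ≤ ∑ κ : Fin 2, 2 * ((n + 1) ^ 7 * μ ^ (n - 1) * Zsum n a b c) := by
        rw [sum_comm]
        refine sum_le_sum fun κ _ => ?_
        rw [sum_add_distrib, two_mul]
        exact add_le_add (hv κ) (hh κ)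
    _ = _ := by simp; ring

/-- The bound on (almost) fault lines for any `ν > 5 / 2` in place of the connective constant. -/
theorem exists_piSet_faultLines_le {ν : ℝ} (hν : 5 / 2 < ν) :
    ∃ K : ℝ, 0 < K ∧ ∀ n : ℕ, 1 ≤ n → ∀ a b c : ℝ,
      0 < a → 0 < b → 0 < c → ν * max a b ≤ c →
      piSet n a b c (CFL n ∪ CAFL n) ≤
        K * (n : ℝ) ^ 3 * (c / min a b) * (ν * max a b / c) ^ (n - 1) := by
  have hν0 : 0 < ν := by linarith
  obtain ⟨K, hK, hb⟩ := exists_bound_pow_mul_geometric (q := 5 / 2 / ν) (by positivity)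
    ((div_lt_one hν0).2 hν) 7
  refine ⟨4 * K, by positivity, fun n hn a b c ha hb' hc h => ?_⟩
  have hm : 0 < max a b := lt_max_of_lt_left ha
  have hx : max a b / c ≤ 2 / 5 := by
    rw [div_le_div_iff₀ hc (by norm_num)]; nlinarith
  have hx0 : 0 ≤ max a b / c := by positivity
  have hsq : (max a b / c) ^ 2 ≤ 4 / 25 := (pow_le_pow_left₀ hx0 hx 2).trans (by norm_num)
  have hpi := piSet_faultLines_le (n := n) (μ := 5 / 2 * (max a b / c)) hn ha hb' hc
    (hx.trans_lt (by norm_num)) (by positivity) (by nlinarith)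
  have h1 : 1 ≤ (n : ℝ) ^ 3 := one_le_pow₀ (by exact_mod_cast hn)
  have h2 : 1 ≤ c / min a b := by
    rw [one_le_div (lt_min ha hb')]
    nlinarith [min_le_max (a := a) (b := b)]
  have hpow : (0 : ℝ) ≤ (ν * max a b / c) ^ (n - 1) := by positivity
  have hsplit : (5 / 2 * (max a b / c)) ^ (n - 1) =
      (5 / 2 / ν : ℝ) ^ (n - 1) * (ν * max a b / c) ^ (n - 1) := by
    rw [← mul_pow]; congr 1; field_simp
  calc piSet n a b c (CFL n ∪ CAFL n)
      ≤ 4 * ((n + 1) ^ 7 * (5 / 2 * (max a b / c)) ^ (n - 1)) := hpi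
    _ = 4 * (((n : ℝ) + 1) ^ 7 * (5 / 2 / ν) ^ (n - 1)) * (ν * max a b / c) ^ (n - 1) := by
        rw [hsplit]; ring
    _ ≤ 4 * K * (ν * max a b / c) ^ (n - 1) := by gcongr; exact hb n hn
    _ ≤ 4 * K * (n : ℝ) ^ 3 * (c / min a b) * (ν * max a b / c) ^ (n - 1) := by
        refine mul_le_mul_of_nonneg_right ?_ hpow
        rw [mul_assoc (4 * K)]
        exact le_mul_of_one_le_right (by positivity) (one_le_mul_of_one_le_of_one_le h1 h2)

/-- in the anti-ferroelectric phase `c ≥ 2.639·max(a,b)`, the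
Gibbs measure of `C_FL ∪ C_AFL` is exponentially small:
`π(C_FL ∪ C_AFL) ≤ K·n³·(c/min(a,b))·(2.639·max(a,b)/c)^{n-1}` for an
absolute constant `K` independent of `n`, `a`, `b`, `c`. -/
theorem fault_lines_exponentially_unlikely :
    ∃ K : ℝ, 0 < K ∧ ∀ n : ℕ, 1 ≤ n → ∀ a b c : ℝ,
      0 < a → 0 < b → 0 < c → 2.639 * max a b ≤ c →
      piSet n a b c (CFL n ∪ CAFL n) ≤
        K * (n : ℝ) ^ 3 * (c / min a b) * (2.639 * max a b / c) ^ (n - 1) :=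
  exists_piSet_faultLines_le (by norm_num)
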